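/- arXiv:math/0609262 — 2 statements merged into one kernel-verified Lean document; each statement's English description precedes it below -/
import Mathlib

section
/- The bigraded Poincaré series of the pure trace algebra of two generic 2×2 matrices satisfies P(C_{2,2}; s,t) = 1 / ((1−s)(1−t)(1−s²)(1−st)(1−t²)). -/
open MvPolynomial Matrix

noncomputable section

/-- Index type for the entries of a pair of generic `n × n` matrices:
`Sum.inl (i,j)` indexes the `(i,j)` entry of `x`, `Sum.inr (i,j)` that of `y`. -/
abbrev MatVar (n : ℕ) := (Fin n × Fin n) ⊕ (Fin n × Fin n)

/-- The substitution sending the variables to the entries of the pair `(A, B)`. -/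
def pairSub {K : Type*} [CommSemiring K] {n : ℕ} (A B : Matrix (Fin n) (Fin n) K) :
    MatVar n → K
  | Sum.inl ij => A ij.1 ij.2
  | Sum.inr ij => B ij.1 ij.2

/-- A polynomial function on pairs of `n × n` matrices is `GLₙ`-invariant (for the action
by simultaneous conjugation). -/
def IsMatInvariant {K : Type*} [Field K] {n : ℕ} (f : MvPolynomial (MatVar n) K) : Prop :=
  ∀ (a : GL (Fin n) K) (A B : Matrix (Fin n) (Fin n) K),
    MvPolynomial.eval
        (pairSub ((a : Matrix (Fin n) (Fin n) K) * A * ((a⁻¹ : GL (Fin n) K) : Matrix (Fin n) (Fin n) K))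
          ((a : Matrix (Fin n) (Fin n) K) * B * ((a⁻¹ : GL (Fin n) K) : Matrix (Fin n) (Fin n) K))) f =
      MvPolynomial.eval (pairSub A B) f

/-- The weight giving the bidegree: entries of `x` have weight `(1,0)`,
those of `y` have weight `(0,1)`. -/
def bideg (n : ℕ) : MatVar n → ℕ × ℕ
  | Sum.inl _ => (1, 0)
  | Sum.inr _ => (0, 1)

/-- The bigraded component of bidegree `(p, q)` of the pure trace algebra `C_{n,2}`. -/
def pureComponent (K : Type*) [Field K] (n p q : ℕ) : Set (MvPolynomial (MatVar n) K) :=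
  {f | IsMatInvariant f ∧ f.IsWeightedHomogeneous (bideg n) (p, q)}

/-- `dim_K C_{n,2}^{(p,q)}`. -/
def pureDim (K : Type*) [Field K] (n p q : ℕ) : ℕ :=
  Set.finrank K (pureComponent K n p q)

/-- The bigraded Poincaré series `P(C_{n,2}; s, t)`, with `s` the variable `X 0` and
`t` the variable `X 1`. -/
def purePS2 (K : Type*) [Field K] (n : ℕ) : MvPowerSeries (Fin 2) ℚ :=
  fun d => (pureDim K n (d 0) (d 1) : ℚ)

/-- abbreviation for the power series variable `s`. -/
def ps : MvPowerSeries (Fin 2) ℚ := MvPowerSeries.X 0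

/-- abbreviation for the power series variable `t`. -/
def pt : MvPowerSeries (Fin 2) ℚ := MvPowerSeries.X 1


set_option linter.unusedSimpArgs false
def cntSet {n : ℕ} (w : Fin n → (Fin 2 →₀ ℕ)) (v : Fin 2 →₀ ℕ) : Set (Fin n → ℕ) :=
  {e | ∑ i, e i • w i = v}

lemma cntSet_finite {n : ℕ} (w : Fin n → (Fin 2 →₀ ℕ)) (hw : ∀ i, w i ≠ 0) (v : Fin 2 →₀ ℕ) :
    (cntSet w v).Finite := by
  apply (Set.finite_Iic (fun _ : Fin n => v 0 + v 1)).subset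
  intro e he i
  have h1 : e i • w i ≤ v := by
    rw [← (he : _ = v)]
    exact Finset.single_le_sum (f := fun i => e i • w i) (fun _ _ => bot_le) (Finset.mem_univ i)
  have h2 : w i 0 ≠ 0 ∨ w i 1 ≠ 0 := by
    by_contra! h
    apply hw i
    ext j; fin_cases j <;> simp [h]
  have h30 := h1 0
  have h31 := h1 1
  simp only [Finsupp.smul_apply, smul_eq_mul] at h30 h31
  rcases h2 with h | h
  · have := Nat.le_mul_of_pos_right (e i) (Nat.pos_of_ne_zero h)
    show e i ≤ v 0 + v 1
    omega
  · have := Nat.le_mul_of_pos_right (e i) (Nat.pos_of_ne_zero h)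
    show e i ≤ v 0 + v 1
    omega

def cntPS {n : ℕ} (w : Fin n → (Fin 2 →₀ ℕ)) : MvPowerSeries (Fin 2) ℚ :=
  fun d => ((cntSet w d).ncard : ℚ)

lemma coeff_cntPS {n : ℕ} (w : Fin n → (Fin 2 →₀ ℕ)) (d) :
    MvPowerSeries.coeff d (cntPS w) = ((cntSet w d).ncard : ℚ) := rfl

lemma cnt_rec {n : ℕ} (w : Fin (n+1) → (Fin 2 →₀ ℕ)) (hw : ∀ i, w i ≠ 0) (v : Fin 2 →₀ ℕ) :
    (cntSet w v).ncard = (cntSet (Fin.tail w) v).ncard +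
      if w 0 ≤ v then (cntSet w (v - w 0)).ncard else 0 := by
  classical
  have hA : (Fin.cons 0 '' cntSet (Fin.tail w) v : Set (Fin (n+1) → ℕ)).ncard
      = (cntSet (Fin.tail w) v).ncard :=
    Set.ncard_image_of_injective _ (Fin.cons_right_injective (α := fun _ => ℕ) 0)
  have hsum : ∀ e : Fin (n+1) → ℕ, ∑ i, e i • w i
      = e 0 • w 0 + ∑ i, (Fin.tail e) i • (Fin.tail w) i := fun e => by
    rw [Fin.sum_univ_succ]; rfl
  set B : Set (Fin (n+1) → ℕ) := {e | e ∈ cntSet w v ∧ e 0 ≠ 0} with hB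
  have hBc : B.ncard = if w 0 ≤ v then (cntSet w (v - w 0)).ncard else 0 := by
    split_ifs with h
    · have : B = (fun e : Fin (n+1) → ℕ => e + Pi.single 0 1) '' cntSet w (v - w 0) := by
        ext e
        constructor
        · rintro ⟨he, h0⟩
          refine ⟨e - Pi.single 0 1, ?_, ?_⟩
          · show _ = _
            rw [← (he : _ = v), hsum, hsum e]
            have h1 : Fin.tail (e - Pi.single 0 1) = Fin.tail e := by
              ext i; simp [Fin.tail]
            rw [h1]
            obtain ⟨k, hk⟩ := Nat.exists_eq_succ_of_ne_zero h0
            have h2 : (e - Pi.single 0 1 : Fin (n+1) → ℕ) 0 = k := by simp [hk]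
            rw [h2, hk, Nat.succ_eq_add_one, add_smul, one_smul, add_right_comm, add_tsub_cancel_right]
          · ext i
            refine Fin.cases ?_ (fun j => ?_) i
            · simp; omega
            · simp
        · rintro ⟨e, he, rfl⟩
          refine ⟨?_, by simp⟩
          show _ = _
          have he' : _ = v - w 0 := he
          rw [hsum] at he' ⊢
          have h1 : Fin.tail (e + Pi.single 0 1) = Fin.tail e := by
              ext i; simp [Fin.tail]
          simp only [h1, Pi.add_apply, Pi.single_eq_same, add_smul, one_smul]
          rw [add_right_comm, he', tsub_add_cancel_of_le h]
      rw [this, Set.ncard_image_of_injective _ (add_left_injective _)]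
    · rw [Set.ncard_eq_zero ((cntSet_finite w hw v).subset (fun e he => he.1))]
      ext e
      simp only [Set.mem_empty_iff_false, iff_false]
      rintro ⟨he, h0⟩
      apply h
      rw [← (he : _ = v), hsum]
      obtain ⟨k, hk⟩ := Nat.exists_eq_succ_of_ne_zero h0
      rw [hk, Nat.succ_eq_add_one, add_smul, one_smul, add_right_comm]
      exact le_add_self
  rw [← hBc, ← hA, ← Set.ncard_union_eq ?_ ((cntSet_finite (Fin.tail w) (fun i => hw _) v).image _)
    ((cntSet_finite w hw v).subset (fun e he => he.1))]
  · congr 1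
    ext e
    constructor
    · intro he
      by_cases h0 : e 0 = 0
      · left
        refine ⟨Fin.tail e, ?_, ?_⟩
        · show _ = _
          rw [← (he : _ = v), hsum e, h0]; simp
        · rw [← h0]; exact Fin.cons_self_tail e
      · right; exact ⟨he, h0⟩
    · rintro (⟨e, he, rfl⟩ | he)
      · show _ = _
        rw [hsum]; simpa using (show _ = _ from he)
      · exact he.1
  · rw [Set.disjoint_left]
    rintro _ ⟨e, he, rfl⟩ h
    exact h.2 rfl

lemma cntPS_succ {n : ℕ} (w : Fin (n+1) → (Fin 2 →₀ ℕ)) (hw : ∀ i, w i ≠ 0) :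
    cntPS w * (1 - MvPowerSeries.monomial (w 0) 1) = cntPS (Fin.tail w) := by
  ext d
  rw [mul_sub, mul_one, map_sub, MvPowerSeries.coeff_mul_monomial, coeff_cntPS, coeff_cntPS,
    cnt_rec w hw]
  split_ifs <;> simp [coeff_cntPS]

lemma cntPS_mul {n : ℕ} (w : Fin n → (Fin 2 →₀ ℕ)) (hw : ∀ i, w i ≠ 0) :
    cntPS w * ∏ i, (1 - MvPowerSeries.monomial (w i) 1) = 1 := by
  induction n with
  | zero =>
    ext d
    rw [Fin.prod_univ_zero, mul_one, coeff_cntPS, MvPowerSeries.coeff_one]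
    split_ifs with h
    · have : cntSet w d = Set.univ := by ext e; simp [cntSet, h]
      rw [this]; simp
    · have : cntSet w d = ∅ := by ext e; simp [cntSet, eq_comm, h]
      rw [this]; simp
  | succ n ih =>
    rw [Fin.prod_univ_succ, ← mul_assoc, cntPS_succ w hw]
    exact ih (Fin.tail w) (fun i => hw _)

def wt5F : Fin 5 → (Fin 2 →₀ ℕ) :=
  ![Finsupp.single 0 1, Finsupp.single 1 1, Finsupp.single 0 2,
    Finsupp.single 0 1 + Finsupp.single 1 1, Finsupp.single 1 2]


lemma cnt_final : cntPS wt5F * ((1 - ps) * (1 - pt) * (1 - ps ^ 2) * (1 - ps * pt) * (1 - pt ^ 2)) = 1 := by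
  have h := cntPS_mul wt5F (by
    intro i h
    have h0 := DFunLike.congr_fun h 0
    have h1 := DFunLike.congr_fun h 1
    fin_cases i <;> simp [wt5F] at h0 h1)
  rw [Fin.prod_univ_five] at h
  have e1 : ps ^ 2 = MvPowerSeries.monomial (Finsupp.single 0 2) 1 := by
    rw [ps, MvPowerSeries.X_pow_eq]
  have e2 : pt ^ 2 = MvPowerSeries.monomial (Finsupp.single 1 2) 1 := by
    rw [pt, MvPowerSeries.X_pow_eq]
  have e3 : ps * pt = MvPowerSeries.monomial (Finsupp.single 0 1 + Finsupp.single 1 1) 1 := by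
    rw [ps, pt, MvPowerSeries.X, MvPowerSeries.X, MvPowerSeries.monomial_mul_monomial, mul_one]
  rw [e1, e2, e3]
  exact h

section alg
variable {K : Type*} [Field K]

lemma quad_zero [Infinite K] (P : Polynomial K) (a b : K) (ha : a ≠ 0)
    (h : ∀ c, P.eval (a * c ^ 2 + b * c) = 0) : P = 0 := by
  have h1 : P.comp (Polynomial.C a * Polynomial.X ^ 2 + Polynomial.C b * Polynomial.X) = 0 := by
    apply Polynomial.funext
    intro c
    simpa using h c
  rw [Polynomial.comp_eq_zero_iff] at h1
  rcases h1 with h1 | ⟨_, h1⟩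
  · exact h1
  · exfalso
    have := congrArg (fun q => Polynomial.coeff q 2) h1
    simp [Polynomial.coeff_X, Polynomial.coeff_C] at this
    exact ha this

lemma eval_line {σ : Type*} (f : MvPolynomial σ K) (v : σ → Polynomial K) (c : K) :
    (aeval v f).eval c = eval (fun i => (v i).eval c) f := by
  induction f using MvPolynomial.induction_on with
  | C a => simp
  | add p q hp hq => simp [hp, hq]
  | mul_X p i hp => simp [hp]

lemma line_quad [Infinite K] {σ : Type*} (f : MvPolynomial σ K) (v : σ → Polynomial K) (a b : K)
    (ha : a ≠ 0)
    (h : ∀ c, eval (fun i => (v i).eval (a * c ^ 2 + b * c)) f = 0) (q : K) :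
    eval (fun i => (v i).eval q) f = 0 := by
  rw [← eval_line, quad_zero (aeval v f) a b ha, Polynomial.eval_zero]
  intro c
  rw [eval_line, h]

lemma line_ne [Infinite K] {σ : Type*} (f : MvPolynomial σ K) (v : σ → Polynomial K)
    (h : ∀ c, c ≠ 0 → eval (fun i => (v i).eval c) f = 0) (q : K) :
    eval (fun i => (v i).eval q) f = 0 := by
  have : Polynomial.X * aeval v f = 0 := by
    apply Polynomial.funext
    intro c
    by_cases hc : c = 0
    · simp [hc]
    · simp [eval_line, h c hc]
  rw [← eval_line, (mul_eq_zero.1 this).resolve_left Polynomial.X_ne_zero, Polynomial.eval_zero]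

/-- value at a pair of 2x2 matrices -/
def ev (f : MvPolynomial (MatVar 2) K) (a b c d a' b' c' d' : K) : K :=
  eval (pairSub !![a, b; c, d] !![a', b'; c', d']) f

lemma ev_poly (f : MvPolynomial (MatVar 2) K) (a b c d a' b' c' d' : Polynomial K) (t : K) :
    eval (fun i => ((pairSub !![a, b; c, d] !![a', b'; c', d']) i).eval t) f =
      ev f (a.eval t) (b.eval t) (c.eval t) (d.eval t) (a'.eval t) (b'.eval t) (c'.eval t)
        (d'.eval t) := by
  unfold ev
  congr 1
  congr 1
  funext i
  rcases i with ⟨i, j⟩ | ⟨i, j⟩ <;> fin_cases i <;> fin_cases j <;> simp [pairSub]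

lemma eq_zero_of_ev [Infinite K] (f : MvPolynomial (MatVar 2) K)
    (h : ∀ a b c d a' b' c' d', ev f a b c d a' b' c' d' = 0) : f = 0 := by
  apply MvPolynomial.funext
  intro x
  rw [map_zero, ← h (x (.inl (0,0))) (x (.inl (0,1))) (x (.inl (1,0))) (x (.inl (1,1)))
    (x (.inr (0,0))) (x (.inr (0,1))) (x (.inr (1,0))) (x (.inr (1,1)))]
  unfold ev
  congr 2
  funext i
  rcases i with ⟨i, j⟩ | ⟨i, j⟩ <;> fin_cases i <;> fin_cases j <;> simp [pairSub]

lemma inv_mat {f : MvPolynomial (MatVar 2) K} (hf : IsMatInvariant f)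
    (P A B A' B' : Matrix (Fin 2) (Fin 2) K) (hP : P.det ≠ 0) (hA : P * A = A' * P)
    (hB : P * B = B' * P) : eval (pairSub A' B') f = eval (pairSub A B) f := by
  have h := hf (Matrix.GeneralLinearGroup.mkOfDetNeZero P hP) A B
  set a := Matrix.GeneralLinearGroup.mkOfDetNeZero P hP with ha
  have haP : (a : Matrix (Fin 2) (Fin 2) K) = P := rfl
  have h1 : (a : Matrix (Fin 2) (Fin 2) K) * ((a⁻¹ : GL (Fin 2) K) : Matrix (Fin 2) (Fin 2) K) = 1 := by
    rw [← Units.val_mul, mul_inv_cancel, Units.val_one]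
  rw [haP] at h h1
  rw [hA, hB, mul_assoc, mul_assoc, h1, mul_one, mul_one] at h
  exact h

lemma ev_conj {f : MvPolynomial (MatVar 2) K} (hf : IsMatInvariant f)
    (p q r s a b c d a' b' c' d' a1 b1 c1 d1 a1' b1' c1' d1' : K) (hP : p * s - q * r ≠ 0)
    (hA : !![p, q; r, s] * !![a, b; c, d] = !![a1, b1; c1, d1] * !![p, q; r, s])
    (hB : !![p, q; r, s] * !![a', b'; c', d'] = !![a1', b1'; c1', d1'] * !![p, q; r, s]) :
    ev f a1 b1 c1 d1 a1' b1' c1' d1' = ev f a b c d a' b' c' d' :=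
  inv_mat hf _ _ _ _ _ (by rw [Matrix.det_fin_two_of]; exact hP) hA hB

lemma mat_eq (p q r s a b c d a1 b1 c1 d1 : K)
    (h1 : p * a + q * c = a1 * p + b1 * r) (h2 : p * b + q * d = a1 * q + b1 * s)
    (h3 : r * a + s * c = c1 * p + d1 * r) (h4 : r * b + s * d = c1 * q + d1 * s) :
    !![p, q; r, s] * !![a, b; c, d] = !![a1, b1; c1, d1] * !![p, q; r, s] := by
  rw [Matrix.mul_fin_two, Matrix.mul_fin_two, h1, h2, h3, h4]

lemma ev_scale {f : MvPolynomial (MatVar 2) K} (hf : IsMatInvariant f) (x1 x2 u y1 y2 v : K)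
    (hu : u ≠ 0) : ev f x1 1 0 x2 y1 0 (u * v) y2 = ev f x1 u 0 x2 y1 0 v y2 := by
  apply ev_conj hf 1 0 0 u
  · simpa using hu
  · apply mat_eq <;> ring
  · apply mat_eq <;> ring

section
open Polynomial in
lemma slice_zero [Infinite K] {f : MvPolynomial (MatVar 2) K} (hf : IsMatInvariant f)
    (h : ∀ x1 x2 y1 y2 v, ev f x1 1 0 x2 y1 0 v y2 = 0) : f = 0 := by
  have s2 : ∀ x1 u x2 y1 v y2, ev f x1 u 0 x2 y1 0 v y2 = 0 := by
    intro x1 u x2 y1 v y2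
    have := line_ne f (pairSub !![C x1, X; C 0, C x2] !![C y1, C 0; C v, C y2]) (by
      intro c hc
      rw [ev_poly]
      simp only [Polynomial.eval_C, Polynomial.eval_X]
      rw [← ev_scale hf _ _ _ _ _ _ hc, h]) u
    rw [ev_poly] at this
    simpa only [Polynomial.eval_C, Polynomial.eval_X] using this
  have s3 : ∀ x1 u x2 p q r s, r ≠ 0 → ev f x1 u 0 x2 p q r s = 0 := by
    intro x1 u x2 p q r s hr
    have := line_quad f (pairSub !![C x1, C u; C 0, C x2] !![C p, X; C r, C s]) r (s - p) hr (by
      intro c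
      rw [ev_poly]
      simp only [Polynomial.eval_C, Polynomial.eval_X]
      rw [← ev_conj hf 1 (-c) 0 1 _ _ _ _ _ _ _ _ x1 (u - c * x2 + c * x1) 0 x2
        (p - c * r) 0 r (s + r * c), s2]
      · simp
      · apply mat_eq <;> ring
      · apply mat_eq <;> ring) q
    rw [ev_poly] at this
    simpa only [Polynomial.eval_C, Polynomial.eval_X] using this
  have s4 : ∀ x1 u x2 p q r s, ev f x1 u 0 x2 p q r s = 0 := by
    intro x1 u x2 p q r s
    have := line_ne f (pairSub !![C x1, C u; C 0, C x2] !![C p, C q; X, C s]) (by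
      intro c hc
      rw [ev_poly]
      simp only [Polynomial.eval_C, Polynomial.eval_X]
      rw [s3 _ _ _ _ _ _ _ hc]) r
    rw [ev_poly] at this
    simpa only [Polynomial.eval_C, Polynomial.eval_X] using this
  have s5 : ∀ p q r s a b c d, q ≠ 0 → ev f p q r s a b c d = 0 := by
    intro p q r s a b c d hq
    have := line_quad f (pairSub !![C p, C q; X, C s] !![C a, C b; C c, C d]) q (p - s) hq (by
      intro t
      rw [ev_poly]
      simp only [Polynomial.eval_C, Polynomial.eval_X]
      rw [← ev_conj hf 1 0 (-t) 1 _ _ _ _ _ _ _ _ (p + q * t) q 0 (s - q * t)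
        (a + b * t) b (c - t * a + (d - t * b) * t) (d - t * b), s4]
      · simp
      · apply mat_eq <;> ring
      · apply mat_eq <;> ring) r
    rw [ev_poly] at this
    simpa only [Polynomial.eval_C, Polynomial.eval_X] using this
  apply eq_zero_of_ev
  intro p q r s a b c d
  have := line_ne f (pairSub !![C p, X; C r, C s] !![C a, C b; C c, C d]) (by
      intro c hc
      rw [ev_poly]
      simp only [Polynomial.eval_C, Polynomial.eval_X]
      rw [s5 _ _ _ _ _ _ _ _ hc]) q
  rw [ev_poly] at this
  simpa only [Polynomial.eval_C, Polynomial.eval_X] using this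

lemma ev_flip [Infinite K] {f : MvPolynomial (MatVar 2) K} (hf : IsMatInvariant f)
    (x1 x2 y1 y2 m : K) :
    ev f x1 1 0 x2 y1 0 m y2 = ev f x1 m 0 x2 y1 0 1 y2 := by
  have key : aeval (pairSub !![Polynomial.C x1, 1; 0, Polynomial.C x2] !![Polynomial.C y1, 0; Polynomial.X, Polynomial.C y2]) f =
      aeval (pairSub !![Polynomial.C x1, Polynomial.X; 0, Polynomial.C x2] !![Polynomial.C y1, 0; 1, Polynomial.C y2]) f := by
    have : Polynomial.X * (aeval (pairSub !![Polynomial.C x1, 1; 0, Polynomial.C x2] !![Polynomial.C y1, 0; Polynomial.X, Polynomial.C y2]) f -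
      aeval (pairSub !![Polynomial.C x1, Polynomial.X; 0, Polynomial.C x2] !![Polynomial.C y1, 0; 1, Polynomial.C y2]) f) = 0 := by
      apply Polynomial.funext
      intro c
      by_cases hc : c = 0
      · simp [hc]
      · have := ev_scale hf x1 x2 c y1 y2 1 hc
        rw [mul_one] at this
        simp [eval_line, ev_poly, this]
    exact sub_eq_zero.1 ((mul_eq_zero.1 this).resolve_left Polynomial.X_ne_zero)
  have := congrArg (Polynomial.eval m) key
  simpa [eval_line, ev_poly] using this
end

lemma ev_swapx {f : MvPolynomial (MatVar 2) K} (hf : IsMatInvariant f)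
    (x1 x2 y1 y2 w : K) :
    ev f x1 1 0 x2 y1 0 (w - x1 * y1 - x2 * y2) y2 =
      ev f x2 1 0 x1 y1 0 (w - x2 * y1 - x1 * y2) y2 := by
  symm
  apply ev_conj hf 1 0 (x1 - x2) 1
  · simp
  · apply mat_eq <;> ring
  · apply mat_eq <;> ring

lemma ev_swapy [Infinite K] {f : MvPolynomial (MatVar 2) K} (hf : IsMatInvariant f)
    (x1 x2 y1 y2 w : K) :
    ev f x1 1 0 x2 y1 0 (w - x1 * y1 - x2 * y2) y2 =
      ev f x1 1 0 x2 y2 0 (w - x1 * y2 - x2 * y1) y1 := by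
  rw [ev_flip hf, ev_flip hf]
  symm
  apply ev_conj hf 1 (y2 - y1) 0 1
  · simp
  · apply mat_eq <;> ring
  · apply mat_eq <;> ring

/-- restriction to the slice -/
def rho : MvPolynomial (MatVar 2) K →ₐ[K] MvPolynomial (Fin 5) K :=
  aeval (pairSub !![X 0, 1; 0, X 1] !![X 2, 0; X 4 - X 0 * X 2 - X 1 * X 3, X 3])

lemma eval_aeval' {σ τ : Type*} (f : MvPolynomial σ K) (v : σ → MvPolynomial τ K) (c : τ → K) :
    eval c (aeval v f) = eval (fun i => eval c (v i)) f := by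
  induction f using MvPolynomial.induction_on with
  | C a => simp
  | add p q hp hq => simp only [map_add, hp, hq]
  | mul_X p i hp => simp only [map_mul, hp, aeval_X, eval_X]

lemma eval_rho (f : MvPolynomial (MatVar 2) K) (c : Fin 5 → K) :
    eval c (rho f) = ev f (c 0) 1 0 (c 1) (c 2) 0 (c 4 - c 0 * c 2 - c 1 * c 3) (c 3) := by
  unfold rho ev
  rw [eval_aeval']
  congr 2
  funext i
  rcases i with ⟨i, j⟩ | ⟨i, j⟩ <;> fin_cases i <;> fin_cases j <;> simp [pairSub]

def psi : MvPolynomial (Fin 5) K →ₐ[K] MvPolynomial (Fin 5) K :=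
  aeval ![X 0 + X 1, X 2 + X 3, X 0 * X 1, X 4, X 2 * X 3]

def swx : MvPolynomial (Fin 5) K →ₐ[K] MvPolynomial (Fin 5) K :=
  aeval ![X 1, X 0, X 2, X 3, X 4]

def swy : MvPolynomial (Fin 5) K →ₐ[K] MvPolynomial (Fin 5) K :=
  aeval ![X 0, X 1, X 3, X 2, X 4]

lemma swx_psi (h : MvPolynomial (Fin 5) K) : swx (psi h) = psi h := by
  have : (swx (K := K)).comp psi = psi := by
    ext i : 1
    fin_cases i <;> simp [swx, psi, add_comm, mul_comm]
  exact DFunLike.congr_fun this h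

lemma swy_psi (h : MvPolynomial (Fin 5) K) : swy (psi h) = psi h := by
  have : (swy (K := K)).comp psi = psi := by
    ext i : 1
    fin_cases i <;> simp [swy, psi, add_comm, mul_comm]
  exact DFunLike.congr_fun this h

lemma swx_rho [Infinite K] {f : MvPolynomial (MatVar 2) K} (hf : IsMatInvariant f) :
    swx (rho f) = rho f := by
  apply MvPolynomial.funext
  intro c
  rw [swx, eval_aeval', eval_rho, eval_rho, ev_swapx hf]
  simp

lemma swy_rho [Infinite K] {f : MvPolynomial (MatVar 2) K} (hf : IsMatInvariant f) :
    swy (rho f) = rho f := by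
  apply MvPolynomial.funext
  intro c
  rw [swy, eval_aeval', eval_rho, eval_rho, ev_swapy hf]
  simp

lemma decomp (g : MvPolynomial (Fin 5) K) : ∃ α β γ δ : MvPolynomial (Fin 5) K,
    g = psi α + X 0 * psi β + X 2 * psi γ + X 0 * X 2 * psi δ := by
  have e0 : psi (X 0 : MvPolynomial (Fin 5) K) = X 0 + X 1 := by simp [psi]
  have e1 : psi (X 1 : MvPolynomial (Fin 5) K) = X 2 + X 3 := by simp [psi]
  have e2 : psi (X 2 : MvPolynomial (Fin 5) K) = X 0 * X 1 := by simp [psi]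
  have e3 : psi (X 3 : MvPolynomial (Fin 5) K) = X 4 := by simp [psi]
  have e4 : psi (X 4 : MvPolynomial (Fin 5) K) = X 2 * X 3 := by simp [psi]
  induction g using MvPolynomial.induction_on with
  | C a => exact ⟨C a, 0, 0, 0, by simp [psi]⟩
  | add p q hp hq =>
    obtain ⟨α, β, γ, δ, rfl⟩ := hp
    obtain ⟨α', β', γ', δ', rfl⟩ := hq
    refine ⟨α + α', β + β', γ + γ', δ + δ', ?_⟩
    simp only [map_add]; ring
  | mul_X p i hp =>
    obtain ⟨α, β, γ, δ, rfl⟩ := hp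
    have h : i = 0 ∨ i = 1 ∨ i = 2 ∨ i = 3 ∨ i = 4 := by omega
    rcases h with rfl | rfl | rfl | rfl | rfl
    · refine ⟨-X 2 * β, α + X 0 * β, -X 2 * δ, γ + X 0 * δ, ?_⟩
      simp only [map_add, map_mul, map_neg, e0, e1, e2, e3, e4]; ring
    · refine ⟨X 0 * α + X 2 * β, -α, X 0 * γ + X 2 * δ, -γ, ?_⟩
      simp only [map_add, map_mul, map_neg, e0, e1, e2, e3, e4]; ring
    · refine ⟨-X 4 * γ, -X 4 * δ, α + X 1 * γ, β + X 1 * δ, ?_⟩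
      simp only [map_add, map_mul, map_neg, e0, e1, e2, e3, e4]; ring
    · refine ⟨X 1 * α + X 4 * γ, X 1 * β + X 4 * δ, -α, -β, ?_⟩
      simp only [map_add, map_mul, map_neg, e0, e1, e2, e3, e4]; ring
    · refine ⟨X 3 * α, X 3 * β, X 3 * γ, X 3 * δ, ?_⟩
      simp only [map_add, map_mul, map_neg, e0, e1, e2, e3, e4]; ring

lemma sym_mem (g : MvPolynomial (Fin 5) K) (hx : swx g = g) (hy : swy g = g) :
    ∃ α, g = psi α := by
  obtain ⟨α, β, γ, δ, rfl⟩ := decomp g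
  have x0 : swx (X 0 : MvPolynomial (Fin 5) K) = X 1 := by simp [swx]
  have x2 : swx (X 2 : MvPolynomial (Fin 5) K) = X 2 := by simp [swx]
  have y2 : swy (X 2 : MvPolynomial (Fin 5) K) = X 3 := by simp [swy]
  have n1 : (X 0 - X 1 : MvPolynomial (Fin 5) K) ≠ 0 :=
    sub_ne_zero.2 (fun h => absurd (X_injective h) (by decide))
  have n2 : (X 2 - X 3 : MvPolynomial (Fin 5) K) ≠ 0 :=
    sub_ne_zero.2 (fun h => absurd (X_injective h) (by decide))
  simp only [map_add, map_mul, swx_psi, x0, x2] at hx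
  have h1 : (X 0 - X 1 : MvPolynomial (Fin 5) K) * (psi β + X 2 * psi δ) = 0 := by
    linear_combination -hx
  have h1 := (mul_eq_zero.1 h1).resolve_left n1
  have h2 : psi α + X 0 * psi β + X 2 * psi γ + X 0 * X 2 * psi δ = psi α + X 2 * psi γ := by
    linear_combination X 0 * h1
  rw [h2] at hy ⊢
  simp only [map_add, map_mul, swy_psi, y2] at hy
  have h3 : (X 2 - X 3 : MvPolynomial (Fin 5) K) * psi γ = 0 := by
    linear_combination -hy
  have h3 := (mul_eq_zero.1 h3).resolve_left n2
  exact ⟨α, by rw [h3]; ring⟩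

def gens : Fin 5 → MvPolynomial (MatVar 2) K :=
  ![X (.inl (0,0)) + X (.inl (1,1)), X (.inr (0,0)) + X (.inr (1,1)),
    X (.inl (0,0)) * X (.inl (1,1)) - X (.inl (0,1)) * X (.inl (1,0)),
    X (.inl (0,0)) * X (.inr (0,0)) + X (.inl (0,1)) * X (.inr (1,0)) +
      X (.inl (1,0)) * X (.inr (0,1)) + X (.inl (1,1)) * X (.inr (1,1)),
    X (.inr (0,0)) * X (.inr (1,1)) - X (.inr (0,1)) * X (.inr (1,0))]

def phi : MvPolynomial (Fin 5) K →ₐ[K] MvPolynomial (MatVar 2) K := aeval gens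

lemma rho_phi (h : MvPolynomial (Fin 5) K) : rho (phi h) = psi h := by
  have : (rho (K := K)).comp phi = psi := by
    ext i : 1
    fin_cases i <;> simp [rho, psi, phi, gens, pairSub]
    ring
  exact DFunLike.congr_fun this h

lemma eval_phi (h : MvPolynomial (Fin 5) K) (A B : Matrix (Fin 2) (Fin 2) K) :
    eval (pairSub A B) (phi h) =
      eval ![A.trace, B.trace, A.det, (A * B).trace, B.det] h := by
  rw [phi, eval_aeval']
  congr 2
  funext i
  fin_cases i <;> simp [gens, pairSub, Matrix.trace_fin_two, Matrix.det_fin_two, Matrix.mul_apply]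
  ring

lemma phi_inv (h : MvPolynomial (Fin 5) K) : IsMatInvariant (phi h) := by
  intro a A B
  have h1 : ((a⁻¹ : GL (Fin 2) K) : Matrix (Fin 2) (Fin 2) K) * (a : Matrix (Fin 2) (Fin 2) K) = 1 := by
    rw [← Units.val_mul, inv_mul_cancel, Units.val_one]
  have ht : ∀ A : Matrix (Fin 2) (Fin 2) K, ((a : Matrix (Fin 2) (Fin 2) K) * A *
      ((a⁻¹ : GL (Fin 2) K) : Matrix (Fin 2) (Fin 2) K)).trace = A.trace := by
    intro A
    rw [Matrix.trace_mul_comm, ← mul_assoc, h1, one_mul]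
  have hd : ∀ A : Matrix (Fin 2) (Fin 2) K, ((a : Matrix (Fin 2) (Fin 2) K) * A *
      ((a⁻¹ : GL (Fin 2) K) : Matrix (Fin 2) (Fin 2) K)).det = A.det := by
    intro A
    rw [Matrix.det_mul_comm, ← mul_assoc, h1, one_mul]
  have hm : ((a : Matrix (Fin 2) (Fin 2) K) * A *
      ((a⁻¹ : GL (Fin 2) K) : Matrix (Fin 2) (Fin 2) K)) * ((a : Matrix (Fin 2) (Fin 2) K) * B *
      ((a⁻¹ : GL (Fin 2) K) : Matrix (Fin 2) (Fin 2) K)) = (a : Matrix (Fin 2) (Fin 2) K) * (A * B) *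
      ((a⁻¹ : GL (Fin 2) K) : Matrix (Fin 2) (Fin 2) K) := by
    simp only [mul_assoc]
    rw [← mul_assoc _ (a : Matrix (Fin 2) (Fin 2) K) _, h1, one_mul]
  rw [eval_phi, eval_phi, hm, ht, ht, ht, hd, hd]

lemma inv_eq_phi [Infinite K] {f : MvPolynomial (MatVar 2) K} (hf : IsMatInvariant f) :
    ∃ h, f = phi h := by
  obtain ⟨α, hα⟩ := sym_mem (rho f) (swx_rho hf) (swy_rho hf)
  refine ⟨α, sub_eq_zero.1 (slice_zero (f := f - phi α) ?_ ?_)⟩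
  · intro a A B
    rw [map_sub, map_sub, hf a A B, phi_inv α a A B]
  · intro x1 x2 y1 y2 v
    have := eval_rho (f - phi α) ![x1, x2, y1, y2, v + x1 * y1 + x2 * y2]
    rw [map_sub, rho_phi, hα, sub_self, map_zero] at this
    simp at this
    have e : v + x1 * y1 + x2 * y2 - x1 * y1 - x2 * y2 = v := by ring
    rw [e] at this
    exact this.symm

open Polynomial in
lemma phi_inj [Infinite K] : Function.Injective (phi (K := K)) := by
  rw [injective_iff_map_eq_zero]
  intro h hh
  have h0 : psi h = 0 := by rw [← rho_phi, hh, map_zero]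
  have h1 : ∀ x1 x2 y1 y2 w : K, MvPolynomial.eval ![x1 + x2, y1 + y2, x1 * x2, w, y1 * y2] h = 0 := by
    intro x1 x2 y1 y2 w
    have := congrArg (MvPolynomial.eval ![x1, x2, y1, y2, w]) h0
    rw [psi, eval_aeval', map_zero] at this
    rw [← this]
    congr 2
    funext i
    fin_cases i <;> simp
  have e : ∀ (a b c d e : K[X]) (t : K), (fun i => (![a, b, c, d, e] i).eval t) =
    ![a.eval t, b.eval t, c.eval t, d.eval t, e.eval t] := by
    intro a b c d e t
    funext i
    fin_cases i <;> rfl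
  have h2 : ∀ T D y1 y2 w : K, MvPolynomial.eval ![T, y1 + y2, D, w, y1 * y2] h = 0 := by
    intro T D y1 y2 w
    have := line_quad h ![C T, C (y1 + y2), X, C w, C (y1 * y2)] (-1) T (by simp) (by
      intro c
      rw [e, ← h1 c (T - c) y1 y2 w]
      simp only [Polynomial.eval_C, Polynomial.eval_X]
      congr 3
      · ring
      · ring_nf) D
    rw [e] at this
    simpa only [Polynomial.eval_C, Polynomial.eval_X] using this
  have h3 : ∀ T D S E w : K, MvPolynomial.eval ![T, S, D, w, E] h = 0 := by
    intro T D S E w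
    have := line_quad h ![C T, C S, C D, C w, X] (-1) S (by simp) (by
      intro c
      rw [e, ← h2 T D c (S - c) w]
      simp only [Polynomial.eval_C, Polynomial.eval_X]
      ring_nf) E
    rw [e] at this
    simpa only [Polynomial.eval_C, Polynomial.eval_X] using this
  apply MvPolynomial.funext
  intro x
  rw [map_zero, ← h3 (x 0) (x 2) (x 1) (x 4) (x 3)]
  congr 2
  funext i
  fin_cases i <;> rfl

def wt5 : Fin 5 → ℕ × ℕ := ![(1, 0), (0, 1), (2, 0), (1, 1), (0, 2)]

lemma gens_hom (i : Fin 5) : (gens (K := K) i).IsWeightedHomogeneous (bideg 2) (wt5 i) := by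
  have hx : ∀ ij, (X (.inl ij) : MvPolynomial (MatVar 2) K).IsWeightedHomogeneous (bideg 2) (1, 0) :=
    fun ij => isWeightedHomogeneous_X K (bideg 2) (.inl ij)
  have hy : ∀ ij, (X (.inr ij) : MvPolynomial (MatVar 2) K).IsWeightedHomogeneous (bideg 2) (0, 1) :=
    fun ij => isWeightedHomogeneous_X K (bideg 2) (.inr ij)
  have h : i = 0 ∨ i = 1 ∨ i = 2 ∨ i = 3 ∨ i = 4 := by omega
  rcases h with rfl | rfl | rfl | rfl | rfl
  · exact (hx _).add (hx _)
  · exact (hy _).add (hy _)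
  · exact ((hx _).mul (hx _)).sub ((hx _).mul (hx _))
  · exact ((((hx _).mul (hy _)).add ((hx _).mul (hy _))).add ((hx _).mul (hy _))).add ((hx _).mul (hy _))
  · exact ((hy _).mul (hy _)).sub ((hy _).mul (hy _))

lemma phi_hom {h : MvPolynomial (Fin 5) K} {m : ℕ × ℕ} (hh : h.IsWeightedHomogeneous wt5 m) :
    (phi h).IsWeightedHomogeneous (bideg 2) m := by
  rw [h.as_sum, map_sum]
  apply IsWeightedHomogeneous.sum
  intro d hd
  have hd' := hh (mem_support_iff.1 hd)
  rw [phi, aeval_monomial, ← hd', ← zero_add (Finsupp.weight wt5 d)]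
  apply IsWeightedHomogeneous.mul (isWeightedHomogeneous_C _ _)
  rw [Finsupp.weight_apply]
  apply IsWeightedHomogeneous.prod
  intro i _
  exact (gens_hom i).pow _

lemma comp_phi (h : MvPolynomial (Fin 5) K) (m : ℕ × ℕ) :
    weightedHomogeneousComponent (bideg 2) m (phi h) = phi (weightedHomogeneousComponent wt5 m h) := by
  induction h using MvPolynomial.induction_on' with
  | monomial u a =>
    have h1 : (monomial u a).IsWeightedHomogeneous wt5 (Finsupp.weight wt5 u) :=
      isWeightedHomogeneous_monomial _ _ _ rfl
    have h2 := phi_hom h1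
    by_cases hm : Finsupp.weight wt5 u = m
    · subst hm
      rw [h1.weightedHomogeneousComponent_same, h2.weightedHomogeneousComponent_same]
    · rw [h1.weightedHomogeneousComponent_ne _ (Ne.symm hm),
        h2.weightedHomogeneousComponent_ne _ (Ne.symm hm), map_zero]
  | add p q hp hq => simp only [map_add, hp, hq]

lemma pureComponent_eq [Infinite K] (p q : ℕ) : pureComponent K 2 p q =
    ((weightedHomogeneousSubmodule K wt5 (p, q)).map phi.toLinearMap : Submodule K _) := by
  ext f
  constructor
  · rintro ⟨hf, hw⟩
    obtain ⟨h, rfl⟩ := inv_eq_phi hf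
    refine ⟨weightedHomogeneousComponent wt5 (p, q) h, ?_, ?_⟩
    · exact weightedHomogeneousComponent_isWeightedHomogeneous _ _
    · show phi _ = _
      rw [← comp_phi, hw.weightedHomogeneousComponent_same]
  · rintro ⟨h, hh, rfl⟩
    exact ⟨phi_inv h, phi_hom hh⟩

lemma pureDim_eq [Infinite K] (p q : ℕ) : pureDim K 2 p q =
    {d : Fin 5 →₀ ℕ | Finsupp.weight wt5 d = (p, q)}.ncard := by
  rw [pureDim, Set.finrank, pureComponent_eq, Submodule.span_eq,
    ← (Submodule.equivMapOfInjective phi.toLinearMap phi_inj _).finrank_eq,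
    weightedHomogeneousSubmodule_eq_finsupp_supported]
  exact Module.finrank_eq_nat_card_basis (basisRestrictSupport K _)

lemma pureDim_cnt [Infinite K] (d : Fin 2 →₀ ℕ) :
    pureDim K 2 (d 0) (d 1) = (cntSet wt5F d).ncard := by
  rw [pureDim_eq, ← Set.ncard_image_of_injective _ (Finsupp.equivFunOnFinite (α := Fin 5) (M := ℕ)).injective]
  congr 1
  have key : ∀ e : Fin 5 →₀ ℕ, Finsupp.weight wt5 e = (d 0, d 1) ↔ ∑ i, e i • wt5F i = d := by
    intro e
    rw [Finsupp.weight_apply, Finsupp.sum_fintype _ _ (by simp), Prod.ext_iff, Finsupp.ext_iff]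
    simp [Fin.sum_univ_five, wt5, wt5F, Fin.forall_fin_two]
  ext e
  constructor
  · rintro ⟨e, he, rfl⟩
    exact (key e).1 he
  · intro he
    exact ⟨Finsupp.equivFunOnFinite.symm e, (key _).2 he, by simp⟩

end alg

/-- The bigraded Poincaré series of the pure trace algebra of two generic `2 × 2`
matrices is `1 / ((1−s)(1−t)(1−s²)(1−st)(1−t²))`. -/
theorem poincare_C22 (K : Type*) [Field K] [CharZero K] :
    purePS2 K 2 * ((1 - ps) * (1 - pt) * (1 - ps ^ 2) * (1 - ps * pt) * (1 - pt ^ 2)) = 1 := by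
  have : Infinite K := CharZero.infinite K
  have h : purePS2 K 2 = cntPS wt5F := by
    funext d
    exact congrArg (Nat.cast) (pureDim_cnt d)
  rw [h]
  exact cnt_final
end
end

section
/- The bigraded Poincaré series of the pure trace algebra of two generic 3×3 matrices satisfies P(C_{3,2}; s,t) = (1 − st + s²t²) / ((1−s)(1−t)·(1−s²)(1−st)²(1−t²)·(1−s³)(1−s²t)(1−st²)(1−t³)). -/
open MvPolynomial Matrix

noncomputable section

namespace PC

section basics
variable {S T : Type*} [CommRing S] [CommRing T]

def Zm (A : Matrix (Fin 3) (Fin 3) S) : Matrix (Fin 3) (Fin 3) S := (3 : S) • A - A.trace • (1 : Matrix (Fin 3) (Fin 3) S)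

def gen (A B : Matrix (Fin 3) (Fin 3) S) : Fin 10 → S :=
  ![A.trace, (Zm A * Zm A).trace, (Zm A).det, B.trace, (Zm A * B).trace, (Zm A * Zm A * B).trace,
    (B * B).trace, (Zm A * (B * B)).trace, (Zm A * Zm A * (B * B)).trace, (B * B * B).trace]

def uu (A B : Matrix (Fin 3) (Fin 3) S) : S := (A * B - B * A).det

lemma trace_map' (f : S →+* T) (A : Matrix (Fin 3) (Fin 3) S) : (A.map f).trace = f A.trace := by
  simp [Matrix.trace, map_sum]

lemma Zm_map (f : S →+* T) (A : Matrix (Fin 3) (Fin 3) S) : Zm (A.map f) = (Zm A).map f := by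
  ext i j
  simp only [Zm, trace_map', Matrix.sub_apply, Matrix.smul_apply, Matrix.map_apply, Matrix.one_apply]
  split_ifs <;> simp [map_ofNat]

lemma gen_map (f : S →+* T) (A B : Matrix (Fin 3) (Fin 3) S) (i : Fin 10) :
    gen (A.map f) (B.map f) i = f (gen A B i) := by
  have hd : ((Zm A).map f).det = f (Zm A).det := (RingHom.map_det f (Zm A)).symm
  simp only [gen, Zm_map, ← Matrix.map_mul, trace_map', hd]
  fin_cases i <;> rfl

lemma uu_map (f : S →+* T) (A B : Matrix (Fin 3) (Fin 3) S) :
    uu (A.map f) (B.map f) = f (uu A B) := by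
  simp only [uu]
  rw [RingHom.map_det]
  rw [RingHom.mapMatrix_apply, Matrix.map_sub f (map_sub f), Matrix.map_mul, Matrix.map_mul]

lemma Zm_conj (g h A : Matrix (Fin 3) (Fin 3) S) (e : h * g = 1) : Zm (g * A * h) = g * Zm A * h := by
  have e' : g * h = 1 := mul_eq_one_comm.mp e
  simp only [Zm, Matrix.mul_sub, Matrix.sub_mul, Matrix.mul_smul, Matrix.smul_mul, Matrix.mul_one, e']
  rw [Matrix.trace_mul_comm, ← Matrix.mul_assoc, e, Matrix.one_mul]

lemma conj_mul (g h A B : Matrix (Fin 3) (Fin 3) S) (e : h * g = 1) :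
    (g * A * h) * (g * B * h) = g * (A * B) * h := by
  calc _ = g * A * (h * g) * B * h := by simp only [Matrix.mul_assoc]
    _ = _ := by rw [e]; simp only [Matrix.mul_assoc, Matrix.mul_one]

lemma conj_trace (g h A : Matrix (Fin 3) (Fin 3) S) (e : h * g = 1) :
    (g * A * h).trace = A.trace := by
  rw [Matrix.trace_mul_comm, ← Matrix.mul_assoc, e, Matrix.one_mul]

lemma conj_det (g h A : Matrix (Fin 3) (Fin 3) S) (e : h * g = 1) :
    (g * A * h).det = A.det := by
  have := congrArg Matrix.det e
  rw [Matrix.det_mul, Matrix.det_one] at this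
  rw [Matrix.det_mul, Matrix.det_mul]
  linear_combination A.det * this

lemma gen_conj (g h A B : Matrix (Fin 3) (Fin 3) S) (e : h * g = 1) :
    gen (g * A * h) (g * B * h) = gen A B := by
  simp only [gen, Zm_conj g h A e, conj_mul _ _ _ _ e, conj_trace _ _ _ e, conj_det _ _ _ e]

lemma uu_conj (g h A B : Matrix (Fin 3) (Fin 3) S) (e : h * g = 1) :
    uu (g * A * h) (g * B * h) = uu A B := by
  simp only [uu, conj_mul _ _ _ _ e, ← Matrix.mul_sub, ← Matrix.sub_mul, conj_det _ _ _ e]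

lemma Zm_tr (A : Matrix (Fin 3) (Fin 3) S) : Zm Aᵀ = (Zm A)ᵀ := by
  simp [Zm]

lemma gen_tr (A B : Matrix (Fin 3) (Fin 3) S) : gen Aᵀ Bᵀ = gen A B := by
  simp only [gen, Zm_tr, ← Matrix.transpose_mul, Matrix.trace_transpose, Matrix.det_transpose]
  rw [Matrix.trace_mul_comm B, Matrix.trace_mul_comm B, Matrix.trace_mul_comm (B * B) (Zm A),
    Matrix.trace_mul_comm (B * B) (Zm A * Zm A), Matrix.mul_assoc B B B]

lemma uu_tr (A B : Matrix (Fin 3) (Fin 3) S) : uu Aᵀ Bᵀ = - uu A B := by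
  simp only [uu, ← Matrix.transpose_mul, ← Matrix.transpose_sub, Matrix.det_transpose]
  rw [← neg_sub, Matrix.det_neg]
  simp only [Fintype.card_fin]
  ring

end basics

section setup
variable (K : Type*) [Field K]

abbrev KM := MvPolynomial (MatVar 3) K
abbrev RR := MvPolynomial (Fin 10) K

def gX : Matrix (Fin 3) (Fin 3) (KM K) := Matrix.of fun i j => X (Sum.inl (i, j))
def gY : Matrix (Fin 3) (Fin 3) (KM K) := Matrix.of fun i j => X (Sum.inr (i, j))

def phi : RR K →ₐ[K] KM K := aeval (gen (gX K) (gY K))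
def ug : KM K := uu (gX K) (gY K)

variable {K}

/-- evaluation at a pair over a K-algebra. -/
def ev {S : Type*} [CommRing S] [Algebra K S] (A B : Matrix (Fin 3) (Fin 3) S) : KM K →ₐ[K] S :=
  aeval (pairSub A B)

variable {S : Type*} [CommRing S] [Algebra K S] 

lemma ev_gX (A B : Matrix (Fin 3) (Fin 3) S) : (gX K).map (ev (K := K) A B : KM K →+* S) = A := by
  ext i j; simp [gX, ev, pairSub]

lemma ev_gY (A B : Matrix (Fin 3) (Fin 3) S) : (gY K).map (ev (K := K) A B : KM K →+* S) = B := by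
  ext i j; simp [gY, ev, pairSub]

lemma ev_gen (A B : Matrix (Fin 3) (Fin 3) S) (i) : ev A B (gen (gX K) (gY K) i) = gen A B i := by
  have := gen_map (ev (K := K) A B : KM K →+* S) (gX K) (gY K) i
  rw [ev_gX, ev_gY] at this
  exact this.symm

lemma ev_phi (A B : Matrix (Fin 3) (Fin 3) S) (a : RR K) : ev A B (phi K a) = aeval (gen A B) a := by
  have : (ev (K := K) A B).comp (phi K) = aeval (gen A B) := by
    apply MvPolynomial.algHom_ext
    intro i
    simp [phi, ev_gen]
  rw [← this]; rfl

lemma ev_ug (A B : Matrix (Fin 3) (Fin 3) S) : ev A B (ug K) = uu A B := by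
  have := uu_map (ev (K := K) A B : KM K →+* S) (gX K) (gY K)
  rw [ev_gX, ev_gY] at this
  exact this.symm

lemma ev_eq_eval (A B : Matrix (Fin 3) (Fin 3) K) (f : KM K) : ev A B f = eval (pairSub A B) f := by
  simp [ev, MvPolynomial.aeval_eq_eval]

lemma ev_ext [Infinite K] {f g : KM K} (h : ∀ A B : Matrix (Fin 3) (Fin 3) K, ev A B f = ev A B g) : f = g := by
  apply MvPolynomial.funext
  intro v
  have := h (Matrix.of fun i j => v (Sum.inl (i, j))) (Matrix.of fun i j => v (Sum.inr (i, j)))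
  have e : pairSub (Matrix.of fun i j => v (Sum.inl (i, j))) (Matrix.of fun i j => v (Sum.inr (i, j))) = v := by
    ext x; rcases x with x | x <;> rfl
  rw [ev_eq_eval, ev_eq_eval, e] at this
  exact this

lemma inv_iff (f : KM K) : IsMatInvariant f ↔ ∀ (g h A B : Matrix (Fin 3) (Fin 3) K), h * g = 1 →
    ev (g * A * h) (g * B * h) f = ev A B f := by
  constructor
  · intro H g h A B e
    have := H ⟨g, h, mul_eq_one_comm.mp e, e⟩ A B
    simpa [ev_eq_eval] using this
  · intro H a A B
    have := H a.1 (a⁻¹).1 A B (by simp [← Units.val_mul])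
    simpa only [ev_eq_eval] using this

lemma inv_phi (a : RR K) : IsMatInvariant (phi K a) := by
  rw [inv_iff]; intro g h A B e
  rw [ev_phi, ev_phi, gen_conj _ _ _ _ e]

lemma inv_ug : IsMatInvariant (ug K) := by
  rw [inv_iff]; intro g h A B e
  rw [ev_ug, ev_ug, uu_conj _ _ _ _ e]

lemma inv_add {f g : KM K} (hf : IsMatInvariant f) (hg : IsMatInvariant g) : IsMatInvariant (f + g) := by
  intro a A B; simp only [map_add, map_sub, map_mul, hf a A B, hg a A B]
lemma inv_sub {f g : KM K} (hf : IsMatInvariant f) (hg : IsMatInvariant g) : IsMatInvariant (f - g) := by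
  intro a A B; simp only [map_add, map_sub, map_mul, hf a A B, hg a A B]
lemma inv_mul {f g : KM K} (hf : IsMatInvariant f) (hg : IsMatInvariant g) : IsMatInvariant (f * g) := by
  intro a A B; simp only [map_add, map_sub, map_mul, hf a A B, hg a A B]

/-- transposition -/
def tau : KM K →ₐ[K] KM K := ev (gX K)ᵀ (gY K)ᵀ

lemma tau_phi (a : RR K) : tau (phi K a) = phi K a := by
  rw [tau, ev_phi, gen_tr]; rfl

lemma tau_ug : tau (ug K) = - ug K := by
  rw [tau, ev_ug, uu_tr]; rfl

end setup

end PC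

namespace PC
section partI
variable {K : Type*} [Field K] [CharZero K]

lemma coord_zero (r : RR K) (v : Fin 10 → K) (i : Fin 10) (s : Set K) (hs : s.Infinite)
    (h : ∀ z ∈ s, eval (Function.update v i z) r = 0) (z : K) : eval (Function.update v i z) r = 0 := by
  let p : Polynomial K := aeval (Function.update (fun j => Polynomial.C (v j)) i Polynomial.X) r
  have hp : ∀ z, p.eval z = eval (Function.update v i z) r := by
    intro z
    have : (Polynomial.aeval z).comp (aeval (R := K) (Function.update (fun j => Polynomial.C (v j)) i (Polynomial.X : Polynomial K)))
        = aeval (Function.update v i z) := by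
      apply MvPolynomial.algHom_ext
      intro j
      by_cases hj : j = i
      · subst hj; simp
      · simp [Function.update_of_ne hj]
    have h2 := congrArg (fun f => f r) this
    simpa [Polynomial.aeval_def, Polynomial.eval₂_eq_eval_map, p, MvPolynomial.aeval_eq_eval] using h2
  have : p = 0 := by
    apply Polynomial.eq_zero_of_infinite_isRoot
    apply hs.mono
    intro z hz
    simp only [Set.mem_setOf_eq, Polynomial.IsRoot, hp]
    exact h z hz
  rw [← hp, this]; simp

lemma quad_inf (a b c : K) (ha : a ≠ 0) : (Set.range fun k : K => a * k ^ 2 + b * k + c).Infinite := by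
  intro hfin
  let p : Polynomial K := Polynomial.C a * Polynomial.X ^ 2 + Polynomial.C b * Polynomial.X + Polynomial.C c
  have hdeg : p.natDegree = 2 := Polynomial.natDegree_quadratic ha
  have : (Set.univ : Set K).Finite := by
    apply Set.Finite.of_finite_fibers (fun k : K => a * k ^ 2 + b * k + c)
    · simpa using hfin
    · intro D _
      have hne : p - Polynomial.C D ≠ 0 := by
        intro h0
        have h1 : p = Polynomial.C D := by linear_combination h0
        rw [h1] at hdeg; simp at hdeg
      apply (Polynomial.finite_setOf_isRoot hne).subset
      rintro k ⟨_, hk⟩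
      simp only [Set.mem_preimage, Set.mem_singleton_iff] at hk
      simp [p, Polynomial.IsRoot, hk]
  exact Set.infinite_univ this

def fam {S : Type*} [CommRing S] (m d : S) : Matrix (Fin 3) (Fin 3) S :=
  !![m + d, 1, 0; 0, m + d, 0; 0, 0, m - 2 * d]

def wf (d a b c : K) : K := b / 9 - 2 * d * a / 3 + c / (27 * d)
def nf (d a b c : K) : K := (c - 6 * d * b + 9 * d ^ 2 * a) / (81 * d ^ 2)

lemma fam_Z {S : Type*} [CommRing S] (m d : S) :
    Zm (fam m d) = !![3 * d, 3, 0; 0, 3 * d, 0; 0, 0, - 6 * d] := by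
  ext i j
  fin_cases i <;> fin_cases j <;> simp [Zm, fam, Matrix.trace_fin_three] <;> ring

lemma fam_01 {S : Type*} [CommRing S] (m d : S) (y : Matrix (Fin 3) (Fin 3) S) :
    gen (fam m d) y 0 = 3 * m ∧ gen (fam m d) y 1 = 54 * d ^ 2 ∧ gen (fam m d) y 2 = - 54 * d ^ 3 := by
  simp only [gen, fam_Z]
  refine ⟨?_, ?_, ?_⟩
  · simp [fam, Matrix.trace_fin_three]; ring
  · simp [Matrix.trace_fin_three]; ring
  · simp [Matrix.det_fin_three]; ring

set_option maxHeartbeats 1000000 in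
lemma fam_surj (m d : K) (hd : d ≠ 0) (t : Fin 10 → K) (h0 : t 0 = 3 * m) (h1 : t 1 = 54 * d ^ 2)
    (h2 : t 2 = - 54 * d ^ 3) (hw : wf d (t 3) (t 4) (t 5) ≠ 0)
    (hal : wf d (t 6) (t 7) (t 8) - wf d (t 3) (t 4) (t 5) * (t 3 - nf d (t 3) (t 4) (t 5)) ≠ 0) :
    {D : K | ∃ y, gen (fam m d) y = Function.update t 9 D}.Infinite := by
  obtain ⟨w, hwd⟩ : ∃ w, w = wf d (t 3) (t 4) (t 5) := ⟨_, rfl⟩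
  obtain ⟨n, hnd⟩ : ∃ w, w = nf d (t 3) (t 4) (t 5) := ⟨_, rfl⟩
  obtain ⟨w2, hw2⟩ : ∃ w, w = wf d (t 6) (t 7) (t 8) := ⟨_, rfl⟩
  obtain ⟨n2, hn2⟩ : ∃ w, w = nf d (t 6) (t 7) (t 8) := ⟨_, rfl⟩
  rw [← hw2, ← hwd, ← hnd] at hal
  rw [← hwd] at hw
  obtain ⟨s, hs⟩ : ∃ s, s = t 3 - n := ⟨_, rfl⟩
  obtain ⟨s2, hs2⟩ : ∃ s, s = t 6 - n2 := ⟨_, rfl⟩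
  rw [← hs] at hal
  obtain ⟨al, hal2⟩ : ∃ al, al = w2 - w * s := ⟨_, rfl⟩
  rw [← hal2] at hal
  obtain ⟨c1, hc1⟩ : ∃ c1, c1 = n2 - n ^ 2 := ⟨_, rfl⟩
  obtain ⟨b, hb⟩ : ∃ b, b = (s2 - s ^ 2 - c1) / (2 * w) := ⟨_, rfl⟩
  have hb' : 2 * b * w = s2 - s ^ 2 - c1 := by rw [hb]; field_simp
  have t3 : t 3 = s + n := by rw [hs]; ring
  have t6 : t 6 = s2 + n2 := by rw [hs2]; ring
  have t4 : t 4 = 3 * d * s + 3 * w - 6 * d * n := by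
    rw [hs, hwd, hnd, wf, nf]; field_simp; ring
  have t5 : t 5 = 9 * d ^ 2 * s + 18 * d * w + 36 * d ^ 2 * n := by
    rw [hs, hwd, hnd, wf, nf]; field_simp; ring
  have t7 : t 7 = 3 * d * s2 + 3 * w2 - 6 * d * n2 := by
    rw [hs2, hw2, hn2, wf, nf]; field_simp; ring
  have t8 : t 8 = 9 * d ^ 2 * s2 + 18 * d * w2 + 36 * d ^ 2 * n2 := by
    rw [hs2, hw2, hn2, wf, nf]; field_simp; ring
  clear hwd hnd hw2 hn2 hs hs2 hb
  have hw2 : w2 = al + w * s := by rw [hal2]; ring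
  have hn2 : n2 = c1 + n ^ 2 := by rw [hc1]; ring
  have hs2 : s2 = 2 * b * w + s ^ 2 + c1 := by rw [hb']; ring
  clear hal2 hc1 hb'
  refine (quad_inf (-3 * (al * w)) (3 * (w * c1 - s * al))
    ((s + n) ^ 3 - 3 * (s + n) * (s * n - b * w - c1) - 3 * b * (w * n - al)) ?_).mono ?_
  · simp [hal, hw]
  rintro _ ⟨k, rfl⟩
  refine ⟨!![s, b, c1 - al * k; w, 0, al; 1, k, n], ?_⟩
  obtain ⟨g0, g1, g2⟩ := fam_01 m d !![s, b, c1 - al * k; w, 0, al; 1, k, n]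
  funext i
  fin_cases i
  · simp [g0, h0]
  · simp [g1, h1]
  · simp [g2, h2]
  · simp [gen, Matrix.trace_fin_three, t3]
  · simp [gen, Matrix.trace_fin_three, t4, fam_Z]; ring
  · simp [gen, Matrix.trace_fin_three, t5, fam_Z]; ring
  · simp [gen, Matrix.trace_fin_three, t6, hs2, hn2]; ring
  · simp [gen, Matrix.trace_fin_three, t7, fam_Z, hs2, hn2, hw2]; ring
  · simp [gen, Matrix.trace_fin_three, t8, fam_Z, hs2, hn2, hw2]; ring
  · simp [gen, Matrix.trace_fin_three]; ring

lemma cofin_inf (a b : K) (ha : a ≠ 0) : {z : K | a * z + b ≠ 0}.Infinite := by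
  have : ({-b / a} : Set K)ᶜ ⊆ {z : K | a * z + b ≠ 0} := by
    intro z hz h
    apply hz
    simp only [Set.mem_singleton_iff]
    field_simp
    linear_combination h
  exact (Set.finite_singleton _).infinite_compl.mono this

lemma fam_zero (G : RR K) (H : ∀ m d y, eval (gen (fam m d) y) G = 0) (m d : K) (hd : d ≠ 0)
    (t : Fin 10 → K) (h0 : t 0 = 3 * m) (h1 : t 1 = 54 * d ^ 2)
    (h2 : t 2 = - 54 * d ^ 3) : eval t G = 0 := by
  have A : ∀ t : Fin 10 → K, t 0 = 3 * m → t 1 = 54 * d ^ 2 → t 2 = - 54 * d ^ 3 →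
      wf d (t 3) (t 4) (t 5) ≠ 0 → 
      wf d (t 6) (t 7) (t 8) - wf d (t 3) (t 4) (t 5) * (t 3 - nf d (t 3) (t 4) (t 5)) ≠ 0 → eval t G = 0 := by
    intro t h0 h1 h2 h3 h4
    have := coord_zero G t 9 _ (fam_surj m d hd t h0 h1 h2 h3 h4) (by
      rintro z ⟨y, hy⟩
      rw [← hy]; exact H m d y) (t 9)
    simpa using this
  have B : ∀ t : Fin 10 → K, t 0 = 3 * m → t 1 = 54 * d ^ 2 → t 2 = - 54 * d ^ 3 →
      wf d (t 3) (t 4) (t 5) ≠ 0 → eval t G = 0 := by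
    intro t h0 h1 h2 h3
    have := coord_zero G t 7 _ (cofin_inf (1/9) (- 2 * d * t 6 / 3 + t 8 / (27 * d) - wf d (t 3) (t 4) (t 5) * (t 3 - nf d (t 3) (t 4) (t 5))) (by norm_num)) (by
      intro z hz
      apply A <;> simp [h0, h1, h2, h3, Function.update]
      intro h; apply hz; simp only [wf] at h ⊢; linear_combination h) (t 7)
    simpa using this
  have := coord_zero G t 4 _ (cofin_inf (1/9) (- 2 * d * t 3 / 3 + t 5 / (27 * d)) (by norm_num)) (by
      intro z hz
      apply B <;> simp [h0, h1, h2, Function.update]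
      intro h; apply hz; rw [← h, wf]; ring) (t 4)
  simpa using this

lemma eval_supp (r : RR K) (hr : r ∈ MvPolynomial.supported K ({2}ᶜ : Set (Fin 10))) (t : Fin 10 → K) (z : K) :
    eval (Function.update t 2 z) r = eval t r := by
  rw [MvPolynomial.mem_supported] at hr
  apply MvPolynomial.eval₂Hom_congr' rfl _ rfl
  intro i hi _
  have : i ≠ 2 := hr hi
  simp [this]

lemma supp_zero (r : RR K) (hr : r ∈ MvPolynomial.supported K ({2}ᶜ : Set (Fin 10)))
    (h : ∀ d : K, d ≠ 0 → ∀ t : Fin 10 → K, t 1 = 54 * d ^ 2 → eval t r = 0) : r = 0 := by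
  apply MvPolynomial.funext
  intro t
  have := coord_zero r t 1 ((Set.range fun k : K => 54 * k ^ 2 + 0 * k + 0) \ {0})
    ((quad_inf 54 0 0 (by norm_num)).diff (Set.finite_singleton 0)) (by
      rintro _ ⟨⟨k, rfl⟩, hk⟩
      apply h k
      · rintro rfl; simp at hk
      · simp) (t 1)
  simpa using this

variable (K) in
def Del : RR K := X 1 ^ 3 - 54 * X 2 ^ 2

lemma div_rem (a : RR K) : ∃ q r0 r1 : RR K, r0 ∈ MvPolynomial.supported K ({2}ᶜ : Set (Fin 10)) ∧
    r1 ∈ MvPolynomial.supported K ({2}ᶜ : Set (Fin 10)) ∧ a = Del K * q + (r0 + r1 * X 2) := by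
  have hX : ∀ i : Fin 10, i ≠ 2 → (X i : RR K) ∈ MvPolynomial.supported K ({2}ᶜ : Set (Fin 10)) := by
    intro i hi
    exact MvPolynomial.X_mem_supported.2 hi
  induction a using MvPolynomial.induction_on with
  | C c => exact ⟨0, C c, 0, Subalgebra.algebraMap_mem _ c, Subalgebra.zero_mem _, by simp⟩
  | add p q hp hq =>
    obtain ⟨q1, a0, a1, h0, h1, rfl⟩ := hp
    obtain ⟨q2, b0, b1, k0, k1, rfl⟩ := hq
    exact ⟨q1 + q2, a0 + b0, a1 + b1, add_mem h0 k0, add_mem h1 k1, by ring⟩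
  | mul_X p i hp =>
    obtain ⟨q1, a0, a1, h0, h1, rfl⟩ := hp
    by_cases hi : i = 2
    · subst hi
      refine ⟨q1 * X 2 - C (1/54) * a1, C (1/54) * (a1 * X 1 ^ 3), a0, ?_, h0, ?_⟩
      · exact mul_mem (Subalgebra.algebraMap_mem _ _) (mul_mem h1 (pow_mem (hX 1 (by decide)) 3))
      · have : (C (1/54) : RR K) * 54 = 1 := by
          have : (54 : RR K) = C 54 := (map_ofNat C 54).symm
          rw [this, ← C_mul]; norm_num
        rw [Del]
        linear_combination (-a1 * X 2 ^ 2) * this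
    · exact ⟨q1 * X i, a0 * X i, a1 * X i, mul_mem h0 (hX i hi), mul_mem h1 (hX i hi), by ring⟩

lemma fam_Del (m d : K) (y) : eval (gen (fam m d) y) (Del K) = 0 := by
  obtain ⟨g0, g1, g2⟩ := fam_01 m d y
  simp [Del, g1, g2]; ring

lemma fam_dvd (a : RR K) (H : ∀ m d y, eval (gen (fam m d) y) a = 0) : Del K ∣ a := by
  obtain ⟨q, r0, r1, h0, h1, rfl⟩ := div_rem a
  have H2 : ∀ m d y, eval (gen (fam m d) y) (r0 + r1 * X 2) = 0 := by
    intro m d y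
    have := H m d y
    rw [map_add, map_mul, fam_Del, zero_mul, zero_add] at this
    exact this
  have key : ∀ d : K, d ≠ 0 → ∀ t : Fin 10 → K, t 1 = 54 * d ^ 2 → eval t r0 = 54 * d ^ 3 * eval t r1 := by
    intro d hd t ht
    have := fam_zero _ H2 (t 0 / 3) d hd (Function.update t 2 (-54 * d ^ 3)) (by simp [Function.update]; ring)
      (by simp [Function.update, ht]) (by simp)
    rw [map_add, map_mul, eval_supp _ h0, eval_supp _ h1, eval_X, Function.update_self] at this
    linear_combination this
  have e1 : r1 = 0 := by
    apply supp_zero _ h1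
    intro d hd t ht
    have k1 := key d hd t ht
    have k2 := key (-d) (neg_ne_zero.2 hd) t (by rw [ht]; ring)
    have : (108 * d ^ 3) * eval t r1 = 0 := by linear_combination k2 - k1
    rcases mul_eq_zero.1 this with h | h
    · exfalso; exact (mul_ne_zero (by norm_num) (pow_ne_zero 3 hd)) h
    · exact h
  have e0 : r0 = 0 := by
    apply supp_zero _ h0
    intro d hd t ht
    rw [key d hd t ht, e1]; simp
  rw [e0, e1]; simp

lemma Del_ne : Del K ≠ 0 := by
  intro h
  have := congrArg (eval (fun i : Fin 10 => if i = 1 then (1 : K) else 0)) h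
  simp [Del] at this

lemma Del_not_unit : ¬ IsUnit (Del K) := by
  intro h
  have := h.map (eval (gen (fam (0:K) 0) 0))
  rw [fam_Del] at this
  simp at this

lemma hpd : phi K (Del K) ≠ 0 := by
  intro h0
  have := ev_phi (K := K) (S := K) (!![1,0,0;0,-1,0;0,0,0]) 0 (Del K)
  rw [h0] at this
  simp [Del, gen, Zm, Matrix.trace_fin_three, Matrix.det_fin_three] at this
  norm_num at this

lemma phi_inj (a : RR K) (h : phi K a = 0) : a = 0 := by
  by_contra hne
  have hf : FiniteMultiplicity (Del K) a := FiniteMultiplicity.of_not_isUnit Del_not_unit hne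
  have key : ∀ c : RR K, phi K c = 0 → Del K ∣ c := by
    intro c hc
    apply fam_dvd
    intro m d y
    have := ev_phi (fam m d) y c
    rw [hc, map_zero] at this
    rw [← MvPolynomial.aeval_eq_eval]; exact this.symm
  have all : ∀ n, Del K ^ n ∣ a := by
    intro n
    induction n with
    | zero => simp
    | succ n ih =>
      obtain ⟨c, rfl⟩ := ih
      rw [map_mul, map_pow] at h
      rcases mul_eq_zero.1 h with h | h
      · exact absurd h (pow_ne_zero _ hpd)
      · rw [pow_succ]; exact mul_dvd_mul_left _ (key c h)
  obtain ⟨n, hn⟩ := hf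
  exact hn (all _)

def psi : KM K →ₐ[K] KM K := ev (fam (X (Sum.inl (0,0))) (X (Sum.inl (0,1)))) (gY K)

lemma ev_psi (A B : Matrix (Fin 3) (Fin 3) K) (f : KM K) :
    ev A B (psi f) = ev (fam (A 0 0) (A 0 1)) B f := by
  have : (ev A B).comp (psi (K := K)) = ev (fam (A 0 0) (A 0 1)) B := by
    apply MvPolynomial.algHom_ext
    rintro (⟨i, j⟩ | ⟨i, j⟩)
    · fin_cases i <;> fin_cases j <;> simp [psi, ev, pairSub, fam]
    · simp [psi, ev, pairSub, gY]
  rw [← this]; rfl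

lemma psi_ug : psi (ug K) ≠ 0 := by
  intro h
  have h2 := ev_psi (K := K) !![0,1,0;0,0,0;0,0,0] !![0,0,0;1,0,1;1,1,0] (ug K)
  rw [h, ev_ug] at h2
  simp [uu, fam, Matrix.det_fin_three] at h2
  norm_num at h2

lemma psi_zero {a : RR K} (h : psi (phi K a) = 0) : Del K ∣ a := by
  apply fam_dvd
  intro m d y
  have h2 := ev_psi (K := K) !![m,d,0;0,0,0;0,0,0] y (phi K a)
  rw [h, ev_phi] at h2
  simpa [MvPolynomial.aeval_eq_eval] using h2.symm

lemma psi_Del : psi (phi K (Del K)) = 0 := by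
  apply ev_ext
  intro A B
  rw [ev_psi, ev_phi, MvPolynomial.aeval_eq_eval, map_zero]
  exact fam_Del _ _ _

lemma descend (f : KM K) (a b : RR K) (h : phi K (Del K) * f = phi K a + ug K * phi K b) :
    ∃ a' b', f = phi K a' + ug K * phi K b' := by
  have ht := congrArg tau h
  simp only [map_mul, map_add, tau_phi, tau_ug] at ht
  have h1 : Del K ∣ a := by
    have e : phi K (Del K) * (f + tau f) = 2 * phi K a := by linear_combination h + ht
    have e2 := congrArg psi e
    rw [map_mul, psi_Del, zero_mul, map_mul, map_ofNat] at e2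
    apply psi_zero
    simpa using e2.symm
  have h2 : Del K ∣ b := by
    have e : phi K (Del K) * (f - tau f) = 2 * (ug K * phi K b) := by linear_combination h - ht
    have e2 := congrArg psi e
    rw [map_mul, psi_Del, zero_mul, map_mul, map_ofNat, map_mul] at e2
    apply psi_zero
    simpa [psi_ug] using e2.symm
  obtain ⟨a', rfl⟩ := h1
  obtain ⟨b', rfl⟩ := h2
  refine ⟨a', b', mul_left_cancel₀ (hpd (K := K)) ?_⟩
  rw [h, map_mul, map_mul]; ring

lemma descend_pow (n : ℕ) (f : KM K) (a b : RR K) (h : phi K (Del K) ^ n * f = phi K a + ug K * phi K b) :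
    ∃ a' b', f = phi K a' + ug K * phi K b' := by
  induction n generalizing f a b with
  | zero => exact ⟨a, b, by simpa using h⟩
  | succ n ih =>
    rw [pow_succ, mul_assoc] at h
    obtain ⟨a', b', h'⟩ := ih _ _ _ h
    exact descend _ _ _ h'

lemma ug_ne : ug K ≠ 0 := by
  intro h; apply psi_ug (K := K); rw [h, map_zero]

lemma Phi_inj (a b : RR K) (h : phi K a + ug K * phi K b = 0) : a = 0 ∧ b = 0 := by
  have ht := congrArg tau h
  simp only [map_mul, map_add, tau_phi, tau_ug, map_zero] at ht
  constructor
  · apply phi_inj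
    have : 2 * phi K a = 0 := by linear_combination h + ht
    simpa using this
  · apply phi_inj
    have : 2 * (ug K * phi K b) = 0 := by linear_combination h - ht
    simpa [ug_ne] using this

end partI
end PC

namespace PC
section partII
variable {K : Type*} [Field K] [CharZero K]

lemma ev_comp {S T : Type*} [CommRing S] [CommRing T] [Algebra K S] [Algebra K T] (th : S →ₐ[K] T)
    (A B : Matrix (Fin 3) (Fin 3) S) (f : KM K) : th (ev A B f) = ev (A.map th) (B.map th) f := by
  have : th.comp (ev A B) = ev (K := K) (A.map th) (B.map th) := by
    apply MvPolynomial.algHom_ext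
    rintro (⟨i, j⟩ | ⟨i, j⟩) <;> simp [ev, pairSub]
  rw [← this]; rfl

def e2m {S : Type*} [CommRing S] (A : Matrix (Fin 3) (Fin 3) S) : S :=
  A 0 0 * A 1 1 - A 0 1 * A 1 0 + A 0 0 * A 2 2 - A 0 2 * A 2 0 + A 1 1 * A 2 2 - A 1 2 * A 2 1

lemma gen1_e {S : Type*} [CommRing S] (A B : Matrix (Fin 3) (Fin 3) S) :
    gen A B 1 = 6 * A.trace ^ 2 - 18 * e2m A := by
  simp [gen, Zm, e2m, Matrix.trace_fin_three, Matrix.mul_apply, Fin.sum_univ_three]; ring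

lemma gen2_e {S : Type*} [CommRing S] (A B : Matrix (Fin 3) (Fin 3) S) :
    gen A B 2 = 27 * A.det - 9 * A.trace * e2m A + 2 * A.trace ^ 3 := by
  simp [gen, Zm, e2m, Matrix.trace_fin_three, Matrix.det_fin_three]; ring

lemma det_scalar {S : Type*} [CommRing S] (A : Matrix (Fin 3) (Fin 3) S) (t : S) :
    (Matrix.scalar (Fin 3) t - A).det = t ^ 3 - A.trace * t ^ 2 + e2m A * t - A.det := by
  simp [e2m, Matrix.trace_fin_three, Matrix.det_fin_three]; ring

lemma diagz {L : Type*} [Field L] [CharZero L] [IsAlgClosed L] (A B : Matrix (Fin 3) (Fin 3) L)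
    (h : gen A B 1 ^ 3 - 54 * gen A B 2 ^ 2 ≠ 0) :
    ∃ (g g' : Matrix (Fin 3) (Fin 3) L) (r : Fin 3 → L), g' * g = 1 ∧ A = g * Matrix.diagonal r * g' := by
  have hs := IsAlgClosed.splits A.charpoly
  have hm := A.charpoly_monic
  have hc : A.charpoly.roots.card = 3 := by
    rw [← hs.natDegree_eq_card_roots, Matrix.charpoly_natDegree_eq_dim]; simp
  obtain ⟨x, y, z, hr⟩ := Multiset.card_eq_three.1 hc
  have hp := hs.eq_prod_roots_of_monic hm
  rw [hr] at hp
  have hev : ∀ t, t ^ 3 - A.trace * t ^ 2 + e2m A * t - A.det = (t - x) * ((t - y) * (t - z)) := by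
    intro t
    rw [← det_scalar, ← Matrix.eval_charpoly, hp]
    simp
  have h0 := hev 0
  have h1 := hev 1
  have h2 := hev (-1)
  have E3 : A.det = x * y * z := by linear_combination -h0
  have E1 : A.trace = x + y + z := by linear_combination (-1/2) * h1 - (1/2) * h2 + h0
  have E2 : e2m A = x * y + x * z + y * z := by linear_combination (1/2) * h1 - (1/2) * h2
  rw [gen1_e, gen2_e, E1, E2, E3] at h
  have h' : 1458 * ((x - y) * (y - z) * (z - x)) ^ 2 ≠ 0 := by
    intro h0; apply h; rw [← h0]; ring
  have hxy : x ≠ y := by rintro rfl; simp at h'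
  have hyz : y ≠ z := by rintro rfl; simp at h'
  have hzx : z ≠ x := by rintro rfl; simp at h'
  let r : Fin 3 → L := ![x, y, z]
  have hinj : Function.Injective r := by
    intro i j hij
    fin_cases i <;> fin_cases j <;> simp_all [r]
    all_goals first | exact absurd hij hzx.symm | skip
  have hev0 : ∀ i, ∃ v : Fin 3 → L, v ≠ 0 ∧ (Matrix.scalar (Fin 3) (r i) - A) *ᵥ v = 0 := by
    intro i
    rw [Matrix.exists_mulVec_eq_zero_iff, det_scalar, hev]
    fin_cases i <;> simp [r]
  choose v hv0 hv using hev0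
  have hAv : ∀ i, A *ᵥ v i = r i • v i := by
    intro i
    have := hv i
    rw [Matrix.sub_mulVec] at this
    simp at this
    exact (sub_eq_zero.1 this).symm
  have hli : LinearIndependent L v := by
    apply Module.End.eigenvectors_linearIndependent' (Matrix.toLin' A) r hinj v
    intro i
    rw [Module.End.hasEigenvector_iff, Module.End.mem_eigenspace_iff]
    exact ⟨by simpa using hAv i, hv0 i⟩
  let g : Matrix (Fin 3) (Fin 3) L := (Matrix.of v)ᵀ
  have hu : IsUnit g := by
    rw [← Matrix.linearIndependent_cols_iff_isUnit]
    exact hli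
  have hdet : IsUnit g.det := (Matrix.isUnit_iff_isUnit_det g).1 hu
  refine ⟨g, g⁻¹, r, Matrix.nonsing_inv_mul g hdet, ?_⟩
  have hAg : A * g = g * Matrix.diagonal r := by
    ext i j
    rw [Matrix.mul_diagonal]
    have := congrFun (hAv j) i
    simp [Matrix.mulVec, dotProduct] at this
    simp [Matrix.mul_apply, g, this]
    ring
  rw [← hAg, Matrix.mul_assoc, Matrix.mul_nonsing_inv g hdet, Matrix.mul_one]

abbrev SI := Fin 3 ⊕ Fin 3 × Fin 3
variable (K) in
abbrev SR := MvPolynomial SI K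

variable (K) in
def sD : Matrix (Fin 3) (Fin 3) (SR K) := Matrix.diagonal fun i => X (Sum.inl i)
variable (K) in
def sY : Matrix (Fin 3) (Fin 3) (SR K) := Matrix.of fun i j => X (Sum.inr (i, j))

def res : KM K →ₐ[K] SR K := ev (sD K) (sY K)

def pt2 {S : Type*} (d : Fin 3 → S) (y : Matrix (Fin 3) (Fin 3) S) : SI → S
  | Sum.inl i => d i
  | Sum.inr ij => y ij.1 ij.2

lemma aeval_res {S : Type*} [CommRing S] [Algebra K S] (d : Fin 3 → S) (y : Matrix (Fin 3) (Fin 3) S) (f : KM K) :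
    aeval (pt2 d y) (res f) = ev (Matrix.diagonal d) y f := by
  rw [res, ev_comp]
  congr 2
  · ext i j
    by_cases h : i = j
    · subst h; simp [sD, pt2]
    · simp [sD, h]
  · ext i j; simp [sY, pt2]

lemma res_inj (f : KM K) (hf : IsMatInvariant f) (h0 : res f = 0) : f = 0 := by
  rw [inv_iff] at hf
  let W := (Fin 3 × Fin 3) ⊕ SI
  let R := MvPolynomial W K
  let G : Matrix (Fin 3) (Fin 3) R := Matrix.of fun i j => X (Sum.inl (i, j))
  let D : Matrix (Fin 3) (Fin 3) R := Matrix.diagonal fun i => X (Sum.inr (Sum.inl i))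
  let Y : Matrix (Fin 3) (Fin 3) R := Matrix.of fun i j => X (Sum.inr (Sum.inr (i, j)))
  let F : R := G.det * ev (G * D * G.adjugate) (G * Y * G.adjugate) f
  have hpt : ∀ {S : Type _} [Field S] [Algebra K S] (v : W → S), aeval v F =
      (Matrix.of fun i j => v (Sum.inl (i, j))).det *
      ev ((Matrix.of fun i j => v (Sum.inl (i, j))) * (Matrix.diagonal fun i => v (Sum.inr (Sum.inl i))) *
        (Matrix.of fun i j => v (Sum.inl (i, j))).adjugate)
        ((Matrix.of fun i j => v (Sum.inl (i, j))) * (Matrix.of fun i j => v (Sum.inr (Sum.inr (i, j)))) *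
        (Matrix.of fun i j => v (Sum.inl (i, j))).adjugate) f := by
    intro S _ _ v
    have hG : G.map (aeval v : R →ₐ[K] S) = Matrix.of fun i j => v (Sum.inl (i, j)) := by
      ext i j; simp [G]
    have hD : D.map (aeval v : R →ₐ[K] S) = Matrix.diagonal fun i => v (Sum.inr (Sum.inl i)) := by
      ext i j
      by_cases h : i = j
      · subst h; simp [D]
      · simp [D, h]
    have hY : Y.map (aeval v : R →ₐ[K] S) = Matrix.of fun i j => v (Sum.inr (Sum.inr (i, j))) := by
      ext i j; simp [Y]
    have hadj : G.adjugate.map (aeval v : R →ₐ[K] S) = (Matrix.of fun i j => v (Sum.inl (i, j))).adjugate := by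
      rw [← hG]
      exact (RingHom.map_adjugate (aeval v : R →ₐ[K] S).toRingHom G)
    have hdet : (aeval v : R →ₐ[K] S) G.det = (Matrix.of fun i j => v (Sum.inl (i, j))).det := by
      rw [← hG]
      exact (RingHom.map_det (aeval v : R →ₐ[K] S).toRingHom G)
    rw [map_mul, ev_comp, hdet, Matrix.map_mul, Matrix.map_mul, Matrix.map_mul, Matrix.map_mul, hG, hD, hY, hadj]
  have hF : F = 0 := by
    apply MvPolynomial.funext
    intro v
    rw [← MvPolynomial.aeval_eq_eval]
    change aeval v F = _
    rw [hpt v]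
    generalize (Matrix.of fun i j => v (Sum.inl (i, j))) = g
    generalize (fun i => v (Sum.inr (Sum.inl i))) = d
    generalize (Matrix.of fun i j => v (Sum.inr (Sum.inr (i, j)))) = y
    by_cases hg : g.det = 0
    · simp [hg]
    · have hu : IsUnit g.det := isUnit_iff_ne_zero.2 hg
      have e1 : ∀ B : Matrix (Fin 3) (Fin 3) K, g * B * g.adjugate = g * (g.det • B) * g⁻¹ := by
        intro B
        rw [Matrix.inv_def]
        simp [hg]
      have e2 : g.det • Matrix.diagonal d = Matrix.diagonal (g.det • d) := by
        rw [Matrix.diagonal_smul]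
      rw [e1, e1, hf _ _ _ _ (Matrix.nonsing_inv_mul g hu), e2, ← aeval_res, h0]
      simp
  let L := AlgebraicClosure K
  haveI : CharZero L := charZero_of_injective_algebraMap (algebraMap K L).injective
  have hL : ∀ A B : Matrix (Fin 3) (Fin 3) L, gen A B 1 ^ 3 - 54 * gen A B 2 ^ 2 ≠ 0 → ev A B f = 0 := by
    intro A B hAB
    obtain ⟨g, g', r, hg, rfl⟩ := diagz A B hAB
    have hgd : g.det ≠ 0 := by
      intro h; have := congrArg Matrix.det hg
      simp [h] at this
    have hu : IsUnit g.det := isUnit_iff_ne_zero.2 hgd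
    have hg' : g' = g⁻¹ := (Matrix.inv_eq_left_inv hg).symm
    let v : W → L := fun w => match w with
      | Sum.inl ij => g ij.1 ij.2
      | Sum.inr (Sum.inl i) => g.det⁻¹ * r i
      | Sum.inr (Sum.inr ij) => (g.det⁻¹ • (g' * B * g)) ij.1 ij.2
    have hv := hpt v
    rw [hF, map_zero] at hv
    have a1 : (Matrix.of fun i j => v (Sum.inl (i, j))) = g := rfl
    have a2 : (Matrix.diagonal fun i => v (Sum.inr (Sum.inl i))) = g.det⁻¹ • Matrix.diagonal r := by
      rw [← Matrix.diagonal_smul]; rfl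
    have a3 : (Matrix.of fun i j => v (Sum.inr (Sum.inr (i, j)))) = g.det⁻¹ • (g' * B * g) := rfl
    have a4 : g.adjugate = g.det • g' := by
      rw [hg', Matrix.inv_def]; simp [hgd]
    rw [a1, a2, a3, a4] at hv
    have hgg : g * g' = 1 := mul_eq_one_comm.mp hg
    have a5 : g * (g.det⁻¹ • Matrix.diagonal r) * (g.det • g') = g * Matrix.diagonal r * g' := by
      simp [smul_smul, hgd]
    have a6 : g * (g.det⁻¹ • (g' * B * g)) * (g.det • g') = B := by
      simp only [Matrix.mul_smul, Matrix.smul_mul, smul_smul]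
      rw [mul_inv_cancel₀ hgd, one_smul]
      calc _ = (g * g') * B * (g * g') := by simp only [Matrix.mul_assoc]
        _ = B := by rw [hgg]; simp
    rw [a5, a6] at hv
    rcases mul_eq_zero.1 hv.symm with h | h
    · exact absurd h hgd
    · exact h
  have hz : phi K (Del K) * f = 0 := by
    apply MvPolynomial.map_injective (algebraMap K L) (algebraMap K L).injective
    rw [map_zero]
    apply MvPolynomial.funext
    intro v
    have e : (eval v) ((MvPolynomial.map (algebraMap K L)) (phi K (Del K) * f)) =
        ev (Matrix.of fun i j => v (Sum.inl (i, j))) (Matrix.of fun i j => v (Sum.inr (i, j))) (phi K (Del K) * f) := by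
      rw [MvPolynomial.eval_map, ev, MvPolynomial.aeval_def]
      congr 1
      ext x; rcases x with x | x <;> rfl
    rw [e, map_mul, ev_phi, map_zero]
    by_cases hc : gen (Matrix.of fun i j => v (Sum.inl (i, j))) (Matrix.of fun i j => v (Sum.inr (i, j))) 1 ^ 3 - 54 * gen (Matrix.of fun i j => v (Sum.inl (i, j))) (Matrix.of fun i j => v (Sum.inr (i, j))) 2 ^ 2 = 0
    · have : aeval (gen (Matrix.of fun i j => v (Sum.inl (i, j))) (Matrix.of fun i j => v (Sum.inr (i, j)))) (Del K) = 0 := by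
        rw [← hc]; simp [Del, map_ofNat]
      rw [this, zero_mul]
    · rw [hL _ _ hc, mul_zero]
  rcases mul_eq_zero.1 hz with h | h
  · exact absurd h hpd
  · exact h

end partII
end PC

namespace PC
section partIIb
variable {K : Type*} [Field K] [CharZero K]

lemma SR_ext {F G : SR K} (h : ∀ d y, aeval (pt2 d y) F = (aeval (pt2 d y) G : K)) : F = G := by
  apply MvPolynomial.funext
  intro v
  have := h (fun i => v (Sum.inl i)) (Matrix.of fun i j => v (Sum.inr (i, j)))
  have e : pt2 (fun i => v (Sum.inl i)) (Matrix.of fun i j => v (Sum.inr (i, j))) = v := by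
    ext x; rcases x with x | x <;> rfl
  rw [e] at this
  simpa [MvPolynomial.aeval_eq_eval] using this

def sact (s : Equiv.Perm (Fin 3)) : SR K →ₐ[K] SR K := rename (Sum.map s (Prod.map s s))

lemma sact_res (s : Equiv.Perm (Fin 3)) (f : KM K) (hf : IsMatInvariant f) : sact s (res f) = res f := by
  rw [inv_iff] at hf
  apply SR_ext
  intro d y
  have e : pt2 d y ∘ (Sum.map s (Prod.map s s)) = pt2 (d ∘ s) (y.submatrix s s) := by
    ext x; rcases x with x | x <;> rfl
  rw [sact, aeval_rename, e, aeval_res, aeval_res]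
  have h1 : ((1 : Matrix (Fin 3) (Fin 3) K).submatrix id s) * ((1 : Matrix (Fin 3) (Fin 3) K).submatrix s id) = 1 := by
    ext i j
    simp [Matrix.mul_apply, Matrix.one_apply]
    rw [Equiv.sum_comp s (fun k => if k = j then if i = k then (1:K) else 0 else 0)]
    simp
  have h2 : ∀ B : Matrix (Fin 3) (Fin 3) K, ((1 : Matrix (Fin 3) (Fin 3) K).submatrix s id) * B * ((1 : Matrix (Fin 3) (Fin 3) K).submatrix id s) = B.submatrix s s := by
    intro B
    ext i j
    simp [Matrix.mul_apply, Matrix.one_apply]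
  have := hf _ _ (Matrix.diagonal d) y h1
  rw [h2, h2] at this
  rw [← this]
  congr 2
  ext i j
  simp [Matrix.diagonal_apply]

/-- the torus scaling -/
def tor (c : Fin 3 → K) : SI → K
  | Sum.inl _ => 1
  | Sum.inr ij => c ij.1 * (c ij.2)⁻¹

lemma tor_res (c : Fin 3 → K) (hc : ∀ i, c i ≠ 0) (f : KM K) (hf : IsMatInvariant f) :
    aeval (fun i => C (tor c i) * X i) (res f) = res f := by
  rw [inv_iff] at hf
  apply SR_ext
  intro d y
  have h1 : Matrix.diagonal (fun i => (c i)⁻¹) * Matrix.diagonal c = 1 := by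
    rw [Matrix.diagonal_mul_diagonal]
    simp [hc]
  have := hf _ _ (Matrix.diagonal d) y h1
  rw [aeval_res d y f, ← this]
  have e : (aeval (pt2 d y)).comp (aeval fun i => (C (tor c i) * X i : SR K)) =
      (aeval (pt2 d (Matrix.diagonal c * y * Matrix.diagonal (fun i => (c i)⁻¹))) : SR K →ₐ[K] K) := by
    apply MvPolynomial.algHom_ext
    rintro (i | ⟨i, j⟩)
    · simp [tor, pt2]
    · simp [tor, pt2]; ring
  have e2 := congrArg (fun h => h (res f)) e
  simp only [AlgHom.comp_apply] at e2
  rw [e2, aeval_res]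
  congr 2
  ext i j
  by_cases h : i = j
  · subst h; simp; field_simp [hc i]
  · simp [h]

lemma coeff_scale (t : SI → K) (F : SR K) (n : SI →₀ ℕ) :
    coeff n (aeval (fun i => C (t i) * X i) F : SR K) = (∏ i, t i ^ n i) * coeff n F := by
  induction F using MvPolynomial.induction_on' with
  | monomial m c =>
    rw [aeval_monomial, Finsupp.prod_fintype _ _ (by simp)]
    simp only [mul_pow, Finset.prod_mul_distrib, ← C_pow]
    have e : (monomial m c : SR K) = C c * ∏ i, X i ^ m i := by
      rw [monomial_eq, Finsupp.prod_fintype _ _ (by simp)]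
    have e2 : (∏ i, C (t i ^ m i) : SR K) = C (∏ i, t i ^ m i) := by rw [map_prod]
    rw [e2]
    have e3 : (algebraMap K (SR K)) c * (C (∏ i, t i ^ m i) * ∏ i, X i ^ m i) = C (∏ i, t i ^ m i) * monomial m c := by
      rw [e, MvPolynomial.algebraMap_eq]; ring
    rw [e3, coeff_C_mul, coeff_monomial]
    split_ifs with h
    · rw [h]
    · simp
  | add p q hp hq => rw [map_add, coeff_add, hp, hq, coeff_add, mul_add]

lemma two_pow_inj (a b : ℕ) (h : (2:K) ^ a = 2 ^ b) : a = b := by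
  have : (2:ℕ) ^ a = 2 ^ b := by exact_mod_cast h
  exact Nat.pow_right_injective le_rfl this

lemma balance (f : KM K) (hf : IsMatInvariant f) (n : SI →₀ ℕ) (hn : coeff n (res f) ≠ 0) :
    n (Sum.inr (0,1)) + n (Sum.inr (0,2)) = n (Sum.inr (1,0)) + n (Sum.inr (2,0)) ∧
    n (Sum.inr (1,0)) + n (Sum.inr (1,2)) = n (Sum.inr (0,1)) + n (Sum.inr (2,1)) := by
  have key : ∀ c : Fin 3 → K, (∀ i, c i ≠ 0) → ∏ i, tor c i ^ n i = 1 := by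
    intro c hc
    have := congrArg (coeff n) (tor_res c hc f hf)
    rw [coeff_scale] at this
    exact mul_right_cancel₀ hn (by rw [this, one_mul])
  constructor
  · have := key ![2,1,1] (by intro i; fin_cases i <;> simp)
    simp [Fintype.prod_sum_type, Fintype.prod_prod_type, Fin.prod_univ_three, tor] at this
    apply two_pow_inj (K := K)
    rw [pow_add, pow_add]
    field_simp at this
    linear_combination this
  · have := key ![1,2,1] (by intro i; fin_cases i <;> simp)
    simp [Fintype.prod_sum_type, Fintype.prod_prod_type, Fin.prod_univ_three, tor] at this
    apply two_pow_inj (K := K)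
    rw [pow_add, pow_add]
    field_simp at this
    linear_combination this

variable (K) in
def l (i : Fin 3) : SR K := X (Sum.inl i)
variable (K) in
def y (i j : Fin 3) : SR K := X (Sum.inr (i, j))
variable (K) in
def pp : SR K := y K 0 1 * y K 1 2 * y K 2 0
variable (K) in
def qq : SR K := y K 0 2 * y K 2 1 * y K 1 0
variable (K) in
def VV : SR K := (l K 0 - l K 1) * (l K 1 - l K 2) * (l K 2 - l K 0)

lemma mon_mem (Q : Subalgebra K (SR K)) (hl : ∀ i, l K i ∈ Q) (hm : ∀ i, y K i i ∈ Q)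
    (ha : y K 1 2 * y K 2 1 ∈ Q) (hb : y K 0 2 * y K 2 0 ∈ Q) (hc : y K 0 1 * y K 1 0 ∈ Q)
    (hp : pp K ∈ Q) (hq : qq K ∈ Q) (n : SI →₀ ℕ) (c : K) 
    (h1 : n (Sum.inr (0,1)) + n (Sum.inr (0,2)) = n (Sum.inr (1,0)) + n (Sum.inr (2,0)))
    (h2 : n (Sum.inr (1,0)) + n (Sum.inr (1,2)) = n (Sum.inr (0,1)) + n (Sum.inr (2,1))) :
    monomial n c ∈ Q := by
  rw [monomial_eq, Finsupp.prod_fintype _ _ (by simp)]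
  apply mul_mem (Subalgebra.algebraMap_mem Q c)
  rw [Fintype.prod_sum_type, Fintype.prod_prod_type]
  apply mul_mem (prod_mem fun i _ => pow_mem (hl i) _)
  simp only [Fin.prod_univ_three]
  change (y K 0 0 ^ _ * y K 0 1 ^ _ * y K 0 2 ^ _) * (y K 1 0 ^ _ * y K 1 1 ^ _ * y K 1 2 ^ _) *
    (y K 2 0 ^ _ * y K 2 1 ^ _ * y K 2 2 ^ _) ∈ Q
  generalize n (Sum.inr (0,0)) = n00 at *
  generalize n (Sum.inr (0,1)) = n01 at *
  generalize n (Sum.inr (0,2)) = n02 at *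
  generalize n (Sum.inr (1,0)) = n10 at *
  generalize n (Sum.inr (1,1)) = n11 at *
  generalize n (Sum.inr (1,2)) = n12 at *
  generalize n (Sum.inr (2,0)) = n20 at *
  generalize n (Sum.inr (2,1)) = n21 at *
  generalize n (Sum.inr (2,2)) = n22 at *
  have hdiag := mul_mem (mul_mem (pow_mem (hm 0) n00) (pow_mem (hm 1) n11)) (pow_mem (hm 2) n22)
  rcases le_total n10 n01 with h | h
  · obtain ⟨d, rfl⟩ := Nat.exists_eq_add_of_le h
    obtain rfl : n12 = n21 + d := by omega
    obtain rfl : n20 = n02 + d := by omega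
    have := mul_mem hdiag (mul_mem (mul_mem (mul_mem (pow_mem ha n21) (pow_mem hb n02)) (pow_mem hc n10)) (pow_mem hp d))
    convert this using 1
    rw [pp]; ring
  · obtain ⟨d, rfl⟩ := Nat.exists_eq_add_of_le h
    obtain rfl : n21 = n12 + d := by omega
    obtain rfl : n02 = n20 + d := by omega
    have := mul_mem hdiag (mul_mem (mul_mem (mul_mem (pow_mem ha n12) (pow_mem hb n20)) (pow_mem hc n01)) (pow_mem hq d))
    convert this using 1
    rw [qq]; ring

variable (K) in
/-- generators restricted to the slice -/
def gs : Fin 10 → SR K := gen (sD K) (sY K)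

lemma res_phi (a : RR K) : res (phi K a) = aeval (gs K) a := ev_phi _ _ _

variable (K) in
def Th : MvPolynomial (Fin 3 ⊕ Fin 10) K →ₐ[K] SR K := aeval (Sum.elim (l K) (gs K))

variable (K) in
def EE : Subalgebra K (SR K) := (Th K).range

lemma l_mem (i) : l K i ∈ EE K := ⟨X (Sum.inl i), by simp [Th]⟩
lemma gs_mem (i) : gs K i ∈ EE K := ⟨X (Sum.inr i), by simp [Th]⟩
lemma VV_mem : VV K ∈ EE K :=
  mul_mem (mul_mem (sub_mem (l_mem _) (l_mem _)) (sub_mem (l_mem _) (l_mem _))) (sub_mem (l_mem _) (l_mem _))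

variable (K) in
def EV : Subalgebra K (SR K) where
  carrier := {F | ∃ k, VV K ^ k * F ∈ EE K}
  mul_mem' := by
    rintro a b ⟨k, hk⟩ ⟨m, hm⟩
    refine ⟨k + m, ?_⟩
    have := mul_mem hk hm
    convert this using 1; ring
  add_mem' := by
    rintro a b ⟨k, hk⟩ ⟨m, hm⟩
    refine ⟨k + m, ?_⟩
    have := add_mem (mul_mem (pow_mem VV_mem m) hk) (mul_mem (pow_mem VV_mem k) hm)
    convert this using 1; ring
  algebraMap_mem' := by
    intro r; exact ⟨0, by simpa using Subalgebra.algebraMap_mem (EE K) r⟩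

lemma EE_le {x} (h : x ∈ EE K) : x ∈ EV K := ⟨0, by simpa using h⟩
lemma EV_of (x : SR K) (h : VV K * x ∈ EE K) : x ∈ EV K := ⟨1, by simpa using h⟩

lemma cmem {S : Type*} [Ring S] [Algebra K S] (Q : Subalgebra K S) (c : K) (hc : c ≠ 0) {x z : S} (h : z ∈ Q) (e : algebraMap K S c * x = z) :
    x ∈ Q := by
  have : x = algebraMap K S c⁻¹ * z := by
    rw [← e, ← mul_assoc, ← map_mul, inv_mul_cancel₀ hc, map_one, one_mul]
  rw [this]; exact mul_mem (Subalgebra.algebraMap_mem Q _) h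

variable (K) in
def ze (i : Fin 3) : SR K := 3 * l K i - (l K 0 + l K 1 + l K 2)

lemma sD_Z : Zm (sD K) = Matrix.diagonal (ze K) := by
  ext i j
  fin_cases i <;> fin_cases j <;> simp [Zm, sD, ze, l, Matrix.trace_fin_three, Fin.sum_univ_three]

lemma ze_mem (i) : ze K i ∈ EE K :=
  sub_mem (mul_mem (by simpa using Subalgebra.algebraMap_mem (EE K) 3) (l_mem _)) (add_mem (add_mem (l_mem _) (l_mem _)) (l_mem _))

lemma lag (W : Matrix (Fin 3) (Fin 3) (SR K)) (h0 : W.trace ∈ EE K) (h1 : (Zm (sD K) * W).trace ∈ EE K)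
    (h2 : (Zm (sD K) * Zm (sD K) * W).trace ∈ EE K) (i : Fin 3) : W i i ∈ EV K := by
  apply EV_of
  have mk : ∀ a b c d : Fin 3, (l K c - l K d) * ((Zm (sD K) * Zm (sD K) * W).trace - (ze K a + ze K b) * (Zm (sD K) * W).trace + ze K a * ze K b * W.trace) ∈ EE K := by
    intro a b c d
    exact mul_mem (sub_mem (l_mem _) (l_mem _)) (add_mem (sub_mem h2 (mul_mem (add_mem (ze_mem _) (ze_mem _)) h1)) (mul_mem (mul_mem (ze_mem _) (ze_mem _)) h0))
  have h9 : algebraMap K (SR K) 9 = 9 := map_ofNat _ 9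
  fin_cases i
  · apply cmem (EE K) (9:K) (by norm_num) (mk 1 2 2 1)
    rw [h9, sD_Z]
    simp [Matrix.trace_fin_three, VV, ze]; ring
  · apply cmem (EE K) (9:K) (by norm_num) (mk 0 2 0 2)
    rw [h9, sD_Z]
    simp [Matrix.trace_fin_three, VV, ze]; ring
  · apply cmem (EE K) (9:K) (by norm_num) (mk 0 1 1 0)
    rw [h9, sD_Z]
    simp [Matrix.trace_fin_three, VV, ze]; ring

lemma mu_mem (i) : y K i i ∈ EV K := lag (sY K) (gs_mem 3) (gs_mem 4) (gs_mem 5) i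
lemma mu2_mem (i) : (sY K * sY K) i i ∈ EV K := lag (sY K * sY K) (gs_mem 6) (gs_mem 7) (gs_mem 8) i

lemma two_alg : algebraMap K (SR K) 2 = 2 := map_ofNat _ 2
lemma three_alg : algebraMap K (SR K) 3 = 3 := map_ofNat _ 3

lemma sY2 (i j) : (sY K * sY K) i j = y K i 0 * y K 0 j + y K i 1 * y K 1 j + y K i 2 * y K 2 j := by
  simp [Matrix.mul_apply, Fin.sum_univ_three, sY, y]

lemma a_mem : y K 1 2 * y K 2 1 ∈ EV K := by
  apply cmem (EV K) (2:K) (by norm_num) (z := (sY K * sY K) 1 1 + (sY K * sY K) 2 2 - (sY K * sY K) 0 0 - y K 1 1 * y K 1 1 - y K 2 2 * y K 2 2 + y K 0 0 * y K 0 0)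
  · exact add_mem (sub_mem (sub_mem (sub_mem (add_mem (mu2_mem _) (mu2_mem _)) (mu2_mem _)) (mul_mem (mu_mem _) (mu_mem _))) (mul_mem (mu_mem _) (mu_mem _))) (mul_mem (mu_mem _) (mu_mem _))
  · rw [two_alg]; simp only [sY2]; ring
lemma b_mem : y K 0 2 * y K 2 0 ∈ EV K := by
  apply cmem (EV K) (2:K) (by norm_num) (z := (sY K * sY K) 0 0 + (sY K * sY K) 2 2 - (sY K * sY K) 1 1 - y K 0 0 * y K 0 0 - y K 2 2 * y K 2 2 + y K 1 1 * y K 1 1)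
  · exact add_mem (sub_mem (sub_mem (sub_mem (add_mem (mu2_mem _) (mu2_mem _)) (mu2_mem _)) (mul_mem (mu_mem _) (mu_mem _))) (mul_mem (mu_mem _) (mu_mem _))) (mul_mem (mu_mem _) (mu_mem _))
  · rw [two_alg]; simp only [sY2]; ring
lemma c_mem : y K 0 1 * y K 1 0 ∈ EV K := by
  apply cmem (EV K) (2:K) (by norm_num) (z := (sY K * sY K) 0 0 + (sY K * sY K) 1 1 - (sY K * sY K) 2 2 - y K 0 0 * y K 0 0 - y K 1 1 * y K 1 1 + y K 2 2 * y K 2 2)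
  · exact add_mem (sub_mem (sub_mem (sub_mem (add_mem (mu2_mem _) (mu2_mem _)) (mu2_mem _)) (mul_mem (mu_mem _) (mu_mem _))) (mul_mem (mu_mem _) (mu_mem _))) (mul_mem (mu_mem _) (mu_mem _))
  · rw [two_alg]; simp only [sY2]; ring

lemma e_mem : pp K + qq K ∈ EV K := by
  apply cmem (EV K) (3:K) (by norm_num) (z := gs K 9 - (y K 0 0 ^ 3 + y K 1 1 ^ 3 + y K 2 2 ^ 3
    + 3 * ((y K 0 0 + y K 1 1) * (y K 0 1 * y K 1 0) + (y K 0 0 + y K 2 2) * (y K 0 2 * y K 2 0) + (y K 1 1 + y K 2 2) * (y K 1 2 * y K 2 1))))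
  · have h3 : (3 : SR K) ∈ EV K := by rw [← three_alg]; exact Subalgebra.algebraMap_mem _ _
    have s := fun i j : Fin 3 => add_mem (mu_mem (K := K) i) (mu_mem (K := K) j)
    have p3 := fun i : Fin 3 => pow_mem (mu_mem (K := K) i) 3
    exact sub_mem (EE_le (gs_mem 9)) (add_mem (add_mem (add_mem (p3 0) (p3 1)) (p3 2)) (mul_mem h3 (add_mem (add_mem (mul_mem (s 0 1) c_mem) (mul_mem (s 0 2) b_mem)) (mul_mem (s 1 2) a_mem))))
  · rw [three_alg]
    simp [gs, gen, Matrix.trace_fin_three, Matrix.mul_apply, Fin.sum_univ_three, pp, qq, sY, y]; ring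

variable (K) in
/-- `EV + (p - q) EV` -/
def EV2 : Subalgebra K (SR K) where
  carrier := {F | ∃ G ∈ EV K, ∃ H ∈ EV K, F = G + (pp K - qq K) * H}
  mul_mem' := by
    rintro _ _ ⟨G, hG, H, hH, rfl⟩ ⟨G', hG', H', hH', rfl⟩
    have hsq : (pp K - qq K) ^ 2 ∈ EV K := by
      have h4 : (4 : SR K) ∈ EV K := by
        have : algebraMap K (SR K) 4 = 4 := map_ofNat _ 4
        rw [← this]; exact Subalgebra.algebraMap_mem _ _
      have := sub_mem (pow_mem (e_mem (K := K)) 2) (mul_mem h4 (mul_mem (mul_mem a_mem b_mem) c_mem))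
      convert this using 1
      rw [pp, qq]; ring
    exact ⟨G * G' + (pp K - qq K) ^ 2 * (H * H'), add_mem (mul_mem hG hG') (mul_mem hsq (mul_mem hH hH')),
      G * H' + H * G', add_mem (mul_mem hG hH') (mul_mem hH hG'), by ring⟩
  add_mem' := by
    rintro _ _ ⟨G, hG, H, hH, rfl⟩ ⟨G', hG', H', hH', rfl⟩
    exact ⟨G + G', add_mem hG hG', H + H', add_mem hH hH', by ring⟩
  algebraMap_mem' := by
    intro r; exact ⟨_, Subalgebra.algebraMap_mem (EV K) r, 0, zero_mem _, by simp⟩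

lemma EV_le {x} (h : x ∈ EV K) : x ∈ EV2 K := ⟨x, h, 0, zero_mem _, by simp⟩

lemma pq_mem : pp K ∈ EV2 K ∧ qq K ∈ EV2 K := by
  have h1 : pp K - qq K ∈ EV2 K := ⟨0, zero_mem _, 1, one_mem _, by simp⟩
  have h2 := EV_le (e_mem (K := K))
  constructor
  · apply cmem (EV2 K) (2:K) (by norm_num) (add_mem h1 h2); rw [two_alg]; ring
  · apply cmem (EV2 K) (2:K) (by norm_num) (sub_mem h2 h1); rw [two_alg]; ring

lemma res_mem (f : KM K) (hf : IsMatInvariant f) : res f ∈ EV2 K := by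
  rw [(res f).as_sum]
  apply sum_mem
  intro n hn
  rw [MvPolynomial.mem_support_iff] at hn
  obtain ⟨h1, h2⟩ := balance f hf n hn
  exact mon_mem _ (fun i => EV_le (EE_le (l_mem i))) (fun i => EV_le (mu_mem i)) (EV_le a_mem) (EV_le b_mem)
    (EV_le c_mem) pq_mem.1 pq_mem.2 n _ h1 h2

end partIIb
end PC

namespace PC
section partIII
variable {K : Type*} [Field K] [CharZero K]

lemma res_ug : res (ug K) = VV K * (pp K - qq K) ∨ res (ug K) = - (VV K * (pp K - qq K)) := by
  have : res (ug K) = uu (sD K) (sY K) := ev_ug _ _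
  rw [this]
  first
  | left; simp [uu, Matrix.det_fin_three, sD, sY, VV, pp, qq, l, y]; ring
  | right; simp [uu, Matrix.det_fin_three, sD, sY, VV, pp, qq, l, y]; ring

lemma res_Del : res (phi K (Del K)) = 1458 * VV K ^ 2 := by
  rw [res_phi]
  simp only [Del, map_sub, map_mul, map_pow, aeval_X, map_ofNat, gs, gen1_e, gen2_e]
  simp [e2m, Matrix.trace_fin_three, Matrix.det_fin_three, sD, VV, l, Fin.sum_univ_three, Fin.prod_univ_three]; ring

variable (K) in
def QQ : Subalgebra K (SR K) := (res.comp (phi K)).range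

lemma gs_QQ (i) : gs K i ∈ QQ K := ⟨X i, by
  have : (res.comp (phi K)) (X i) = res (phi K (X i)) := rfl
  change (res.comp (phi K)) (X i) = _
  rw [this, res_phi, aeval_X]⟩

lemma sym_mem (g : MvPolynomial (Fin 3) K) (hg : g.IsSymmetric) : rename Sum.inl g ∈ QQ K := by
  have hn : ∀ m : ℕ, (m : SR K) ∈ QQ K := fun m => natCast_mem _ m
  have m0 : l K 0 + l K 1 + l K 2 ∈ QQ K := by
    have := gs_QQ (K := K) 0
    simpa [gs, gen, sD, l, Fin.sum_univ_three, Matrix.trace_fin_three] using this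
  have m1 : l K 0 * l K 1 + l K 0 * l K 2 + l K 1 * l K 2 ∈ QQ K := by
    have h1 := gs_QQ (K := K) 1
    apply cmem (QQ K) (18:K) (by norm_num) (sub_mem (mul_mem (hn 6) (pow_mem m0 2)) h1)
    rw [gs, gen1_e]
    have : algebraMap K (SR K) 18 = 18 := map_ofNat _ 18
    rw [this]
    simp [e2m, sD, l, Matrix.trace_fin_three, Fin.sum_univ_three]
  have m2 : l K 0 * l K 1 * l K 2 ∈ QQ K := by
    have h1 := gs_QQ (K := K) 2
    apply cmem (QQ K) (27:K) (by norm_num) (sub_mem (add_mem h1 (mul_mem (hn 9) (mul_mem m0 m1))) (mul_mem (hn 2) (pow_mem m0 3)))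
    rw [gs, gen2_e]
    have : algebraMap K (SR K) 27 = 27 := map_ofNat _ 27
    rw [this]
    simp [e2m, sD, l, Matrix.trace_fin_three, Fin.sum_univ_three, Fin.prod_univ_three, Matrix.det_fin_three]; ring
  obtain ⟨p, hp⟩ := esymmAlgHom_surjective (σ := Fin 3) K (n := 3) (by simp) ⟨g, hg⟩
  have hp' : g = aeval (fun i : Fin 3 => esymm (Fin 3) K (i + 1)) p := by
    rw [← esymmAlgHom_apply, hp]
  have e : rename Sum.inl g = aeval (fun i : Fin 3 => (rename Sum.inl (esymm (Fin 3) K (i + 1)) : SR K)) p := by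
    rw [hp', ← AlgHom.comp_apply]
    congr 1
    apply MvPolynomial.algHom_ext; intro i; simp
  rw [e]
  have hmem : ∀ i : Fin 3, (rename Sum.inl (esymm (Fin 3) K (i + 1)) : SR K) ∈ QQ K := by
    intro i
    have p1 : Finset.powersetCard 1 (Finset.univ : Finset (Fin 3)) = {{0},{1},{2}} := by decide
    have p2 : Finset.powersetCard 2 (Finset.univ : Finset (Fin 3)) = {{0,1},{0,2},{1,2}} := by decide
    have p3 : Finset.powersetCard 3 (Finset.univ : Finset (Fin 3)) = {{0,1,2}} := by decide
    fin_cases i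
    · convert m0 using 1
      simp only [esymm, Fin.zero_eta, Fin.val_zero, zero_add, p1]
      rw [Finset.sum_insert (by decide), Finset.sum_insert (by decide), Finset.sum_singleton]
      simp [l]; ring
    · convert m1 using 1
      change rename Sum.inl (∑ t ∈ Finset.powersetCard 2 (Finset.univ : Finset (Fin 3)), _) = _
      rw [p2, Finset.sum_insert (by decide), Finset.sum_insert (by decide), Finset.sum_singleton]
      simp [l]; ring
    · convert m2 using 1
      change rename Sum.inl (∑ t ∈ Finset.powersetCard 3 (Finset.univ : Finset (Fin 3)), _) = _
      rw [p3, Finset.sum_singleton]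
      simp [l]; ring
  rw [MvPolynomial.aeval_def, MvPolynomial.eval₂_eq]
  apply sum_mem; intro d _
  exact mul_mem (Subalgebra.algebraMap_mem _ _) (prod_mem fun i _ => pow_mem (hmem i) _)

lemma sact_QQ (s) (x : SR K) (hx : x ∈ QQ K) : sact s x = x := by
  obtain ⟨a, rfl⟩ := hx
  exact sact_res s (phi K a) (inv_phi a)

lemma rey (G : SR K) (hG : G ∈ EE K) : ∑ s : Equiv.Perm (Fin 3), sact s G ∈ QQ K := by
  obtain ⟨P, rfl⟩ := hG
  change ∑ s : Equiv.Perm (Fin 3), sact s (Th K P) ∈ QQ K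
  induction P using MvPolynomial.induction_on' with
  | monomial n c =>
    have e : Th K (monomial n c) = rename Sum.inl (C c * ∏ i, X i ^ (n (Sum.inl i)) : MvPolynomial (Fin 3) K) *
        ∏ j, gs K j ^ (n (Sum.inr j)) := by
      rw [Th, aeval_monomial, Finsupp.prod_fintype _ _ (by simp), Fintype.prod_sum_type]
      simp [l, mul_assoc, MvPolynomial.algebraMap_eq]
    rw [e]
    generalize (C c * ∏ i, X i ^ (n (Sum.inl i)) : MvPolynomial (Fin 3) K) = g
    have hb : ∏ j, gs K j ^ (n (Sum.inr j)) ∈ QQ K := prod_mem fun i _ => pow_mem (gs_QQ i) _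
    have e2 : ∀ s : Equiv.Perm (Fin 3), sact s (rename Sum.inl g * ∏ j, gs K j ^ (n (Sum.inr j))) =
        rename Sum.inl (rename s g) * ∏ j, gs K j ^ (n (Sum.inr j)) := by
      intro s
      rw [map_mul, sact_QQ s _ hb, sact, rename_rename, rename_rename]
      rfl
    simp only [e2]
    rw [← Finset.sum_mul, ← map_sum]
    refine mul_mem (sym_mem _ ?_) hb
    intro t
    rw [map_sum]
    simp only [rename_rename]
    exact Fintype.sum_equiv (Equiv.mulLeft t) _ _ (fun s => rfl)
  | add p q hp hq =>
    simp only [map_add, Finset.sum_add_distrib]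
    exact add_mem hp hq

theorem upper (f : KM K) (hf : IsMatInvariant f) : ∃ a b, f = phi K a + ug K * phi K b := by
  obtain ⟨G, ⟨k, hk⟩, H, ⟨m, hm⟩, e⟩ := res_mem f hf
  obtain ⟨c, hc⟩ : ∃ c : K, VV K * (pp K - qq K) = algebraMap K (SR K) c * res (ug K) := by
    rcases res_ug (K := K) with h | h
    · exact ⟨1, by rw [h]; simp⟩
    · exact ⟨-1, by rw [h]; simp⟩
  set N := k + m + 1 with hN
  have hcm : ∀ m : ℕ, (m : SR K) ∈ EE K := fun m => natCast_mem _ m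
  have hG : (1458 : ℕ) ^ N * VV K ^ (k + 2 * m + 2) * (VV K ^ k * G) ∈ EE K :=
    mul_mem (mul_mem (pow_mem (hcm _) _) (pow_mem VV_mem _)) hk
  have hH : (1458 : ℕ) ^ N * VV K ^ (2 * k + m + 1) * algebraMap K (SR K) c * (VV K ^ m * H) ∈ EE K :=
    mul_mem (mul_mem (mul_mem (pow_mem (hcm _) _) (pow_mem VV_mem _)) (Subalgebra.algebraMap_mem _ _)) hm
  obtain ⟨a, ha⟩ := rey _ hG
  obtain ⟨b, hb⟩ := rey _ hH
  change res (phi K a) = _ at ha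
  change res (phi K b) = _ at hb
  have key : res (phi K (Del K ^ N) * f) = (1458 : ℕ) ^ N * VV K ^ (k + 2 * m + 2) * (VV K ^ k * G) +
      res (ug K) * ((1458 : ℕ) ^ N * VV K ^ (2 * k + m + 1) * algebraMap K (SR K) c * (VV K ^ m * H)) := by
    rw [map_mul, map_pow, map_pow, res_Del, e, mul_pow, hN]
    push_cast
    linear_combination 1458 ^ (k+m+1) * VV K ^ (2 * k + 2 * m + 1) * H * hc
  have hi : IsMatInvariant (phi K (Del K ^ N) * f) := inv_mul (inv_phi _) hf
  have h6 : (6 : SR K) * res (phi K (Del K ^ N) * f) = res (phi K a + ug K * phi K b) := by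
    have h1 : ∑ s : Equiv.Perm (Fin 3), sact s (res (phi K (Del K ^ N) * f)) = 6 * res (phi K (Del K ^ N) * f) := by
      simp only [sact_res _ _ hi]
      rw [Finset.sum_const, Finset.card_univ, Fintype.card_perm]
      simp [Nat.factorial]
    rw [← h1, key]
    simp only [map_add (sact _), map_mul (sact _) (res (ug K)), sact_res _ _ (inv_ug (K := K)), Finset.sum_add_distrib, ← Finset.mul_sum]
    rw [← ha, ← hb, ← map_mul, ← map_add]
  have h7 : (6 : KM K) * (phi K (Del K ^ N) * f) - (phi K a + ug K * phi K b) = 0 := by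
    apply res_inj
    · refine inv_sub (inv_mul ?_ hi) (inv_add (inv_phi _) (inv_mul inv_ug (inv_phi _)))
      have := inv_phi (K := K) 6
      rwa [map_ofNat] at this
    · rw [map_sub, map_mul, map_ofNat, h6, sub_self]
  have h8 : phi K (Del K) ^ N * f = phi K (C (6⁻¹) * a) + ug K * phi K (C (6⁻¹) * b) := by
    have hC : (C (6⁻¹:K) : KM K) * 6 = 1 := by
      have : (6 : KM K) = C (6:K) := (map_ofNat C 6).symm
      rw [this, ← C_mul, inv_mul_cancel₀ (by norm_num), C_1]
    have hp : phi K (C (6⁻¹)) = C (6⁻¹ : K) := AlgHom.commutes (phi K) _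
    rw [map_mul, map_mul, hp]
    rw [map_pow] at h7
    linear_combination C (6⁻¹:K) * h7 - (phi K (Del K) ^ N * f) * hC
  exact descend_pow N f _ _ h8

end partIII
end PC

namespace PC
section partIV
variable {K : Type*} [Field K] [CharZero K]

def wt : Fin 10 → ℕ × ℕ := ![(1,0),(2,0),(3,0),(0,1),(1,1),(2,1),(0,2),(1,2),(2,2),(0,3)]

abbrev WH (f : KM K) (d : ℕ × ℕ) : Prop := IsWeightedHomogeneous (bideg 3) f d

def MH (M : Matrix (Fin 3) (Fin 3) (KM K)) (d : ℕ × ℕ) : Prop := ∀ i j, WH (M i j) d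

lemma MH.mul {M N : Matrix (Fin 3) (Fin 3) (KM K)} {d e} (h : MH M d) (h' : MH N e) : MH (M * N) (d + e) := by
  intro i j
  rw [Matrix.mul_apply]
  exact IsWeightedHomogeneous.sum _ _ _ (fun k _ => (h i k).mul (h' k j))

lemma MH.sub {M N : Matrix (Fin 3) (Fin 3) (KM K)} {d} (h : MH M d) (h' : MH N d) : MH (M - N) d := by
  intro i j
  exact (h i j).sub (h' i j)

lemma MH.trace {M : Matrix (Fin 3) (Fin 3) (KM K)} {d} (h : MH M d) : WH M.trace d :=
  IsWeightedHomogeneous.sum _ _ _ (fun k _ => h k k)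

lemma MH.Zm {M : Matrix (Fin 3) (Fin 3) (KM K)} {d} (h : MH M d) : MH (Zm M) d := by
  intro i j
  simp only [PC.Zm, Matrix.sub_apply, Matrix.smul_apply, smul_eq_mul, Matrix.one_apply]
  apply IsWeightedHomogeneous.sub
  · have : (3 : KM K) = C 3 := (map_ofNat C 3).symm
    rw [this]
    exact (h i j).C_mul _
  · split_ifs
    · simpa using h.trace
    · simpa using isWeightedHomogeneous_zero _ _ _

lemma MH.det {M : Matrix (Fin 3) (Fin 3) (KM K)} {d} (h : MH M d) : WH M.det (d + d + d) := by
  have t := fun a b c a' b' c' => ((h a a').mul (h b b')).mul (h c c')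
  rw [Matrix.det_fin_three]
  exact (((((t _ _ _ _ _ _).sub (t _ _ _ _ _ _)).sub (t _ _ _ _ _ _)).add (t _ _ _ _ _ _)).add (t _ _ _ _ _ _)).sub (t _ _ _ _ _ _)

lemma MH_gX : MH (gX K) (1, 0) := fun i j => isWeightedHomogeneous_X _ (bideg 3) (Sum.inl (i, j))
lemma MH_gY : MH (gY K) (0, 1) := fun i j => isWeightedHomogeneous_X _ (bideg 3) (Sum.inr (i, j))

lemma gen_wh (i) : WH (gen (gX K) (gY K) i) (wt i) := by
  have z := (MH_gX (K := K)).Zm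
  have x := MH_gX (K := K)
  have y := MH_gY (K := K)
  fin_cases i
  · exact x.trace
  · exact (z.mul z).trace
  · exact z.det
  · exact y.trace
  · exact (z.mul y).trace
  · exact ((z.mul z).mul y).trace
  · exact (y.mul y).trace
  · exact (z.mul (y.mul y)).trace
  · exact ((z.mul z).mul (y.mul y)).trace
  · exact ((y.mul y).mul y).trace

lemma ug_wh : WH (ug K) (3, 3) := 
  ((MH_gX.mul MH_gY).sub (MH_gY.mul MH_gX : MH _ ((1,0) + (0,1)))).det

def ww (n : Fin 10 →₀ ℕ) : ℕ × ℕ := ∑ i, n i • wt i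

lemma mon_wh (n : Fin 10 →₀ ℕ) (c : K) : WH (phi K (monomial n c)) (ww n) := by
  rw [phi, aeval_monomial, Finsupp.prod_fintype _ _ (by simp), MvPolynomial.algebraMap_eq]
  apply IsWeightedHomogeneous.C_mul
  exact IsWeightedHomogeneous.prod _ _ _ (fun i _ => (gen_wh i).pow _)

variable (K) in
def Psi : RR K × RR K →ₗ[K] KM K :=
  LinearMap.coprod (phi K).toLinearMap ((LinearMap.mulLeft K (ug K)).comp (phi K).toLinearMap)

lemma Psi_apply (a b : RR K) : Psi K (a, b) = phi K a + ug K * phi K b := rfl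

lemma Psi_inj : Function.Injective (Psi K) := by
  rw [← LinearMap.ker_eq_bot, LinearMap.ker_eq_bot']
  rintro ⟨a, b⟩ h
  obtain ⟨rfl, rfl⟩ := Phi_inj a b h
  rfl

def T0 (d : ℕ × ℕ) : Set (Fin 10 →₀ ℕ) := {n | ww n = d}
def T1 (d : ℕ × ℕ) : Set (Fin 10 →₀ ℕ) := {n | (3, 3) + ww n = d}

lemma fin_sum_wh (T : Set (Fin 10 →₀ ℕ)) (a : RR K) (ha : a ∈ restrictSupport K T) (u : KM K) (d)
    (h : ∀ n ∈ T, ∀ c : K, WH (u * phi K (monomial n c)) d) : WH (u * phi K a) d := by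
  rw [a.as_sum, map_sum, Finset.mul_sum]
  apply IsWeightedHomogeneous.sum
  intro n hn
  rw [mem_restrictSupport_iff] at ha
  exact h n (ha hn) _

lemma comp_ex (u : KM K) (e d : ℕ × ℕ) (hu : WH u e) (b : RR K) :
    ∃ b' ∈ restrictSupport K {n | e + ww n = d}, weightedHomogeneousComponent (bideg 3) d (u * phi K b) = u * phi K b' := by
  classical
  induction b using MvPolynomial.induction_on' with
  | monomial n c =>
    have := hu.mul (mon_wh n c)
    by_cases h : e + ww n = d
    · refine ⟨monomial n c, ?_, ?_⟩
      · rw [monomial_mem_restrictSupport]; exact Or.inl h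
      · rw [h] at this
        exact this.weightedHomogeneousComponent_same
    · refine ⟨0, zero_mem _, ?_⟩
      rw [this.weightedHomogeneousComponent_ne d (Ne.symm h)]; simp
  | add p q hp hq =>
    obtain ⟨p', h1, h2⟩ := hp
    obtain ⟨q', h3, h4⟩ := hq
    exact ⟨p' + q', add_mem h1 h3, by rw [map_add, mul_add, map_add, h2, h4, map_add, mul_add]⟩

lemma comp_eq (p q : ℕ) : pureComponent K 3 p q =
    (((restrictSupport K (T0 (p, q))).prod (restrictSupport K (T1 (p, q)))).map (Psi K) : Set (KM K)) := by
  ext f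
  constructor
  · rintro ⟨hf, hw⟩
    obtain ⟨a, b, rfl⟩ := upper f hf
    obtain ⟨a', ha, ea⟩ := comp_ex (1 : KM K) 0 (p, q) (isWeightedHomogeneous_one _ _) a
    obtain ⟨b', hb, eb⟩ := comp_ex (ug K) (3, 3) (p, q) ug_wh b
    refine ⟨(a', b'), ⟨by simpa [T0] using ha, hb⟩, ?_⟩
    rw [Psi_apply, ← eb]
    have h1 := hw.weightedHomogeneousComponent_same
    rw [one_mul, one_mul] at ea
    rw [← ea, ← map_add]
    exact h1
  · rintro ⟨⟨a, b⟩, ⟨ha, hb⟩, rfl⟩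
    rw [Psi_apply]
    refine ⟨inv_add (inv_phi _) (inv_mul inv_ug (inv_phi _)), IsWeightedHomogeneous.add ?_ ?_⟩
    · have := fin_sum_wh _ a ha 1 (p, q) ?_
      · simpa using this
      · intro n hn c
        have := mon_wh (K := K) n c
        rwa [one_mul, ← show ww n = (p, q) from hn]
    · apply fin_sum_wh _ b hb
      intro n hn c
      have := ug_wh.mul (mon_wh (K := K) n c)
      rwa [show (3, 3) + ww n = (p, q) from hn] at this

lemma ww_fin (d : ℕ × ℕ) : (T0 d).Finite := by
  apply Set.Finite.subset (Set.finite_Iic (Finsupp.equivFunOnFinite.symm (fun _ => d.1 + d.2) : Fin 10 →₀ ℕ))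
  intro n hn i
  have h : ww n = d := hn
  have h1 : d.1 + d.2 = ∑ i, n i * ((wt i).1 + (wt i).2) := by
    rw [← h, ww, Prod.fst_sum, Prod.snd_sum, ← Finset.sum_add_distrib]
    simp [mul_add]
  have h2 : 1 ≤ (wt i).1 + (wt i).2 := by revert i; decide
  calc n i ≤ n i * ((wt i).1 + (wt i).2) := Nat.le_mul_of_pos_right _ h2
    _ ≤ ∑ i, n i * ((wt i).1 + (wt i).2) := Finset.single_le_sum (f := fun i => n i * ((wt i).1 + (wt i).2)) (fun _ _ => Nat.zero_le _) (Finset.mem_univ i)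
    _ = d.1 + d.2 := h1.symm

lemma T1_fin (d : ℕ × ℕ) : (T1 d).Finite := by
  apply (ww_fin (d - (3,3))).subset
  intro n hn
  have h : (3, 3) + ww n = d := hn
  change ww n = _
  rw [← h]; simp

theorem dim_eq (p q : ℕ) : pureDim K 3 p q = (T0 (p, q)).ncard + (T1 (p, q)).ncard := by
  rw [pureDim, comp_eq, Set.finrank, Submodule.span_eq]
  rw [← (Submodule.equivMapOfInjective (Psi K) Psi_inj _).finrank_eq]
  have : Finite (T0 (p, q)) := (ww_fin _).to_subtype
  have : Finite (T1 (p, q)) := (T1_fin _).to_subtype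
  have : Module.Finite K (restrictSupport K (T0 (p, q))) := Module.Finite.of_basis (basisRestrictSupport K _)
  have : Module.Finite K (restrictSupport K (T1 (p, q))) := Module.Finite.of_basis (basisRestrictSupport K _)
  let e : ((restrictSupport K (T0 (p, q))).prod (restrictSupport K (T1 (p, q)))) ≃ₗ[K]
      restrictSupport K (T0 (p, q)) × restrictSupport K (T1 (p, q)) :=
    { toFun := fun x => (⟨x.1.1, x.2.1⟩, ⟨x.1.2, x.2.2⟩)
      invFun := fun x => ⟨(x.1.1, x.2.1), ⟨x.1.2, x.2.2⟩⟩
      map_add' := fun _ _ => rfl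
      map_smul' := fun _ _ => rfl
      left_inv := fun _ => rfl
      right_inv := fun _ => rfl }
  rw [e.finrank_eq, Module.finrank_prod, Module.finrank_eq_nat_card_basis (basisRestrictSupport K (T0 (p, q))),
    Module.finrank_eq_nat_card_basis (basisRestrictSupport K (T1 (p, q)))]
  rfl

end partIV
end PC

namespace PC
section partV

def SS {k : ℕ} (w : Fin k → (Fin 2 →₀ ℕ)) (n : Fin k → ℕ) : Fin 2 →₀ ℕ := ∑ i, n i • w i

def HH {k : ℕ} (w : Fin k → (Fin 2 →₀ ℕ)) : MvPowerSeries (Fin 2) ℚ :=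
  fun d => (({n | SS w n = d} : Set (Fin k → ℕ)).ncard : ℚ)

lemma coeff_HH {k : ℕ} (w : Fin k → (Fin 2 →₀ ℕ)) (d) :
    MvPowerSeries.coeff d (HH w) = (({n | SS w n = d} : Set (Fin k → ℕ)).ncard : ℚ) := rfl

lemma SS_fin {k : ℕ} (w : Fin k → (Fin 2 →₀ ℕ)) (hw : ∀ i, w i ≠ 0) (d) : ({n | SS w n = d} : Set (Fin k → ℕ)).Finite := by
  apply Set.Finite.subset (Set.finite_Iic (fun _ : Fin k => Finsupp.degree d))
  intro n hn i
  have h : SS w n = d := hn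
  have h1 : Finsupp.degree d = ∑ i, n i * Finsupp.degree (w i) := by
    rw [← h, SS, map_sum]; simp
  have h2 : 0 < Finsupp.degree (w i) := by
    rw [Nat.pos_iff_ne_zero, Ne, Finsupp.degree_eq_zero_iff]; exact hw i
  calc n i ≤ n i * Finsupp.degree (w i) := Nat.le_mul_of_pos_right _ h2
    _ ≤ ∑ i, n i * Finsupp.degree (w i) := Finset.single_le_sum (f := fun i => n i * Finsupp.degree (w i)) (fun _ _ => Nat.zero_le _) (Finset.mem_univ i)
    _ = _ := h1.symm

/-- shifted count -/
lemma coeff_shift {k : ℕ} (w : Fin k → (Fin 2 →₀ ℕ)) (e d) :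
    MvPowerSeries.coeff d (MvPowerSeries.monomial e 1 * HH w) = (({n | e + SS w n = d} : Set (Fin k → ℕ)).ncard : ℚ) := by
  rw [MvPowerSeries.coeff_monomial_mul]
  split_ifs with h
  · rw [one_mul, coeff_HH]
    congr 2
    ext n
    constructor
    · intro hn
      have hn : SS w n = d - e := hn
      change e + SS w n = d
      rw [hn, add_tsub_cancel_of_le h]
    · intro hn
      have hn : e + SS w n = d := hn
      change SS w n = d - e
      rw [← hn, add_tsub_cancel_left]
  · have : ({n | e + SS w n = d} : Set (Fin k → ℕ)) = ∅ := by
      ext n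
      simp only [Set.mem_setOf_eq, Set.mem_empty_iff_false, iff_false]
      rintro rfl
      exact h le_self_add
    rw [this]; simp

lemma HH_aux {k : ℕ} (w : Fin (k+1) → (Fin 2 →₀ ℕ)) (d : Fin 2 →₀ ℕ) :
    ({n | SS w n = d} : Set (Fin (k+1) → ℕ)) =
      (Fin.cons 0 '' ({n | SS (fun i => w i.succ) n = d} : Set (Fin k → ℕ))) ∪
      ((fun n => n + Pi.single 0 1) '' ({n | w 0 + SS w n = d} : Set (Fin (k+1) → ℕ))) := by
  have hc : ∀ a n, SS w (Fin.cons a n) = a • w 0 + SS (fun i => w i.succ) n := by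
    intro a n; simp [SS, Fin.sum_univ_succ]
  have hs : ∀ a (n : Fin k → ℕ), (Fin.cons a n : Fin (k+1) → ℕ) + Pi.single 0 1 = Fin.cons (a+1) n := by
    intro a n
    ext i
    refine Fin.cases ?_ (fun i => ?_) i <;> simp
  ext n
  obtain ⟨a, n, rfl⟩ : ∃ a m, n = (Fin.cons a m : Fin (k+1) → ℕ) := ⟨n 0, Fin.tail n, (Fin.cons_self_tail n).symm⟩
  constructor
  · intro hn
    have hn : SS w (Fin.cons a n) = d := hn
    rw [hc] at hn
    rcases a with _ | a
    · left; exact ⟨n, by simpa using hn, rfl⟩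
    · right
      refine ⟨Fin.cons a n, ?_, hs a n⟩
      change w 0 + SS w _ = d
      rw [hc, ← hn, add_smul, one_smul]; abel
  · rintro (⟨m, hm, h⟩ | ⟨m, hm, h⟩)
    · rw [← h]
      change SS w _ = d
      rw [hc, zero_smul, zero_add]; exact hm
    · obtain ⟨b, m, rfl⟩ : ∃ a m', m = (Fin.cons a m' : Fin (k+1) → ℕ) := ⟨m 0, Fin.tail m, (Fin.cons_self_tail m).symm⟩
      simp only [Set.mem_setOf_eq] at hm ⊢
      simp only [hs] at h
      rw [hc] at hm
      rw [← h, hc, ← hm, add_smul, one_smul]; abel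

lemma HH_succ {k : ℕ} (w : Fin (k+1) → (Fin 2 →₀ ℕ)) (hw : ∀ i, w i ≠ 0) :
    HH w * (1 - MvPowerSeries.monomial (w 0) 1) = HH (fun i => w i.succ) := by
  rw [mul_sub, mul_one, sub_eq_iff_eq_add, mul_comm]
  ext d
  rw [map_add, coeff_shift, coeff_HH, coeff_HH]
  have e := HH_aux w d
  have hf := SS_fin w hw d
  rw [e] at hf ⊢
  rw [Set.ncard_union_eq ?_ (hf.subset Set.subset_union_left) (hf.subset Set.subset_union_right),
    Set.ncard_image_of_injective _ (Fin.cons_right_injective _), Set.ncard_image_of_injective _ (add_left_injective _)]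
  · push_cast; rfl
  · rw [Set.disjoint_left]
    rintro _ ⟨m, _, rfl⟩ ⟨m', _, h⟩
    have := congrFun h 0
    simp at this

lemma HH_prod {k : ℕ} (w : Fin k → (Fin 2 →₀ ℕ)) (hw : ∀ i, w i ≠ 0) :
    HH w * ∏ i, (1 - MvPowerSeries.monomial (w i) 1) = 1 := by
  induction k with
  | zero =>
    ext d
    simp only [Finset.univ_eq_empty, Finset.prod_empty, mul_one]
    rw [coeff_HH, MvPowerSeries.coeff_one]
    split_ifs with h
    · subst h
      have : ({n | SS w n = 0} : Set (Fin 0 → ℕ)) = Set.univ := by ext n; simp [SS]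
      rw [this]; simp
    · have : ({n | SS w n = d} : Set (Fin 0 → ℕ)) = ∅ := by
        ext n; simpa [SS] using Ne.symm h
      rw [this]; simp
  | succ k ih =>
    rw [Fin.prod_univ_succ, ← mul_assoc, HH_succ w hw]
    exact ih _ (fun i => hw _)

def ws (i : Fin 10) : Fin 2 →₀ ℕ := Finsupp.single 0 (wt i).1 + Finsupp.single 1 (wt i).2

lemma ws_ne (i) : ws i ≠ 0 := by
  intro h
  have h0 := DFunLike.congr_fun h 0
  have h1 := DFunLike.congr_fun h 1
  simp [ws] at h0 h1
  clear h
  revert i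
  decide

lemma SS_iff (n : Fin 10 →₀ ℕ) (e : ℕ × ℕ) (d : Fin 2 →₀ ℕ) :
    Finsupp.single 0 e.1 + Finsupp.single 1 e.2 + SS ws n = d ↔ e + ww n = (d 0, d 1) := by
  have h0 : (SS ws n) 0 = (ww n).1 := by
    simp [SS, ww, ws, Finsupp.finset_sum_apply, Prod.fst_sum]
  have h1 : (SS ws n) 1 = (ww n).2 := by
    simp [SS, ww, ws, Finsupp.finset_sum_apply, Prod.snd_sum]
  rw [Finsupp.ext_iff, Fin.forall_fin_two, Prod.ext_iff]
  simp [h0, h1]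

lemma card_T (e : ℕ × ℕ) (d : Fin 2 →₀ ℕ) :
    ({n | Finsupp.single 0 e.1 + Finsupp.single 1 e.2 + SS ws n = d} : Set (Fin 10 → ℕ)).ncard =
      ({n | e + ww n = (d 0, d 1)} : Set (Fin 10 →₀ ℕ)).ncard := by
  rw [← Set.ncard_image_of_injective _ (DFunLike.coe_injective (F := Fin 10 →₀ ℕ))]
  congr 1
  ext n
  constructor
  · intro h
    refine ⟨Finsupp.equivFunOnFinite.symm n, ?_, rfl⟩
    exact (SS_iff (Finsupp.equivFunOnFinite.symm n) e d).1 h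
  · rintro ⟨m, hm, rfl⟩
    exact (SS_iff m e d).2 hm

theorem PS_eq (K : Type*) [Field K] [CharZero K] :
    purePS2 K 3 = (1 + ps ^ 3 * pt ^ 3) * HH ws := by
  have hm : (ps ^ 3 * pt ^ 3 : MvPowerSeries (Fin 2) ℚ) = MvPowerSeries.monomial (Finsupp.single 0 3 + Finsupp.single 1 3) 1 := by
    rw [ps, pt, MvPowerSeries.X_pow_eq, MvPowerSeries.X_pow_eq, MvPowerSeries.monomial_mul_monomial, one_mul]
  rw [add_mul, one_mul, hm]
  ext d
  have h0 := card_T 0 d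
  have h1 := card_T (3, 3) d
  rw [map_add, coeff_shift, coeff_HH]
  change ((pureDim K 3 (d 0) (d 1) : ℕ) : ℚ) = _
  rw [dim_eq]
  simp only [Prod.fst_zero, Prod.snd_zero, Finsupp.single_zero, zero_add] at h0
  rw [h0, h1]
  push_cast
  rfl

end partV
end PC

/-- The bigraded Poincaré series of the pure trace algebra of two generic `3 × 3`
matrices is `(1 − st + s²t²) / ((1−s)(1−t)(1−s²)(1−st)²(1−t²)(1−s³)(1−s²t)(1−st²)(1−t³))`. -/
theorem poincare_C32 (K : Type*) [Field K] [CharZero K] :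
    purePS2 K 3 *
        ((1 - ps) * (1 - pt) * (1 - ps ^ 2) * (1 - ps * pt) ^ 2 * (1 - pt ^ 2) *
          (1 - ps ^ 3) * (1 - ps ^ 2 * pt) * (1 - ps * pt ^ 2) * (1 - pt ^ 3)) =
      1 - ps * pt + ps ^ 2 * pt ^ 2 := by
  have hne : (1 + ps * pt : MvPowerSeries (Fin 2) ℚ) ≠ 0 := by
    intro h
    have := congrArg MvPowerSeries.constantCoeff h
    simp [ps, pt] at this
  have hmon : ∀ i, (MvPowerSeries.monomial (PC.ws i) 1 : MvPowerSeries (Fin 2) ℚ) = ps ^ (PC.wt i).1 * pt ^ (PC.wt i).2 := by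
    intro i
    rw [ps, pt, MvPowerSeries.X_pow_eq, MvPowerSeries.X_pow_eq, MvPowerSeries.monomial_mul_monomial, one_mul]; rfl
  have hp := PC.HH_prod PC.ws PC.ws_ne
  simp only [hmon, Fin.prod_univ_succ] at hp
  simp [PC.wt] at hp
  apply mul_right_cancel₀ hne
  rw [PC.PS_eq]
  linear_combination (1 + ps ^ 3 * pt ^ 3) * hp
end
end
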